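/- arXiv:2509.10294 — 10 statements merged into one kernel-verified Lean document; each statement's English description precedes it below -/
import Mathlib

section
/- Let 𝒬₁ and 𝒬₂ be finite posets, not both empty, such that 𝒬₁ does not have a unique minimal element and 𝒬₂ does not have a unique maximal element. If ℱ is a 𝒬₁*𝒬₂-saturated family of subsets of [n], then ℱ is also a 𝒬₁*•*𝒬₂-saturated family of subsets of [n]. -/
open Finset

/-- A family `F` of subsets of `[n]` (as subsets of `Fin n`) contains an induced copy of
the finite poset `P`: there is an injection `f : P → F` with `a ≤ b ↔ f a ⊆ f b`. -/
def ContainsCopy (P : Type) [PartialOrder P] {n : ℕ}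
    (F : Set (Finset (Fin n))) : Prop :=
  ∃ f : P → Finset (Fin n), Function.Injective f ∧ (∀ a, f a ∈ F) ∧
    ∀ a b : P, a ≤ b ↔ f a ⊆ f b

/-- `F` is `P`-saturated: it contains no induced copy of `P`, but adding any new set
creates one. -/
def IsSaturated (P : Type) [PartialOrder P] {n : ℕ}
    (F : Finset (Finset (Fin n))) : Prop :=
  ¬ ContainsCopy P (↑F : Set (Finset (Fin n))) ∧
    ∀ S : Finset (Fin n), S ∉ F →
      ContainsCopy P (insert S (↑F : Set (Finset (Fin n))))

/-- The induced saturation number `sat*(n, P)`. -/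
noncomputable def satStar (n : ℕ) (P : Type) [PartialOrder P] : ℕ :=
  sInf {m | ∃ F : Finset (Finset (Fin n)), IsSaturated P F ∧ F.card = m}

/-- The antichain poset `𝒜_k` with `k` elements. -/
def AC (k : ℕ) : Type := Fin k

instance (k : ℕ) : PartialOrder (AC k) where
  le a b := a = b
  le_refl _ := rfl
  le_trans _ _ _ h₁ h₂ := Eq.trans h₁ h₂
  le_antisymm _ _ h _ := h

instance (k : ℕ) : Fintype (AC k) := inferInstanceAs (Fintype (Fin k))

/-- Two order embeddings, the first lying strictly below the second, glue to an order embedding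
of the lexicographic sum. -/
theorem exists_sumLex_orderEmbedding {α P Q : Type*} [PartialOrder α] [PartialOrder P]
    [PartialOrder Q] (g : P ↪o α) (h : Q ↪o α) (hgh : ∀ p q, g p < h q) :
    ∃ e : P ⊕ₗ Q ↪o α, (∀ p, e (Sum.inlₗ p) = g p) ∧ ∀ q, e (Sum.inrₗ q) = h q := by
  refine ⟨OrderEmbedding.ofMapLEIff (fun x => Sum.elim g h (ofLex x)) ?_,
    fun _ => rfl, fun _ => rfl⟩
  rintro (a | a) (b | b)
  · exact g.le_iff_le.trans Sum.Lex.inl_le_inl_iff.symm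
  · exact iff_of_true (hgh a b).le (Sum.Lex.inl_le_inr a b)
  · exact iff_of_false (hgh b a).not_ge Sum.Lex.not_inr_le_inl
  · exact h.le_iff_le.trans Sum.Lex.inr_le_inr_iff.symm

/-- `F` contains a copy of `P` placed strictly below a copy of `Q`. -/
def HasStackedCopy {α : Type*} [PartialOrder α] (P Q : Type*) [PartialOrder P] [PartialOrder Q]
    (F : Set α) : Prop :=
  ∃ (g : P ↪o α) (h : Q ↪o α), (∀ p, g p ∈ F) ∧ (∀ q, h q ∈ F) ∧ ∀ p q, g p < h q

theorem HasStackedCopy.dual {α P Q : Type*} [PartialOrder α] [PartialOrder P] [PartialOrder Q]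
    {F : Set α} (H : HasStackedCopy P Q F) :
    HasStackedCopy Qᵒᵈ Pᵒᵈ (OrderDual.ofDual ⁻¹' F) :=
  let ⟨g, h, hg, hh, hgh⟩ := H
  ⟨h.dual, g.dual, hh, hg, fun q p => hgh p q⟩

theorem HasStackedCopy.of_dual {α P Q : Type*} [PartialOrder α] [PartialOrder P] [PartialOrder Q]
    {F : Set α} (H : HasStackedCopy Qᵒᵈ Pᵒᵈ (OrderDual.ofDual ⁻¹' F)) :
    HasStackedCopy P Q F :=
  let ⟨g, h, hg, hh, hgh⟩ := H
  ⟨OrderEmbedding.dual h, OrderEmbedding.dual g, hh, hg, fun p q => hgh q p⟩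

theorem containsCopy_iff_exists_orderEmbedding {P : Type} [PartialOrder P] {n : ℕ}
    {F : Set (Finset (Fin n))} :
    ContainsCopy P F ↔ ∃ e : P ↪o Finset (Fin n), ∀ a, e a ∈ F := by
  constructor
  · rintro ⟨f, -, hf, hle⟩
    exact ⟨OrderEmbedding.ofMapLEIff f fun a b => (hle a b).symm, hf⟩
  · rintro ⟨e, he⟩
    exact ⟨e, e.injective, he, fun a b => e.le_iff_le.symm⟩

theorem containsCopy_sumLex_iff {P Q : Type} [PartialOrder P] [PartialOrder Q] {n : ℕ}
    {F : Set (Finset (Fin n))} : ContainsCopy (P ⊕ₗ Q) F ↔ HasStackedCopy P Q F := by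
  rw [containsCopy_iff_exists_orderEmbedding]
  constructor
  · rintro ⟨e, he⟩
    refine ⟨OrderEmbedding.ofMapLEIff (fun p => e (Sum.inlₗ p)) fun a b => ?_,
      OrderEmbedding.ofMapLEIff (fun q => e (Sum.inrₗ q)) fun a b => ?_,
      fun _ => he _, fun _ => he _, fun p q => e.lt_iff_lt.2 (Sum.Lex.inl_lt_inr p q)⟩
    · exact e.le_iff_le.trans Sum.Lex.inl_le_inl_iff
    · exact e.le_iff_le.trans Sum.Lex.inr_le_inr_iff
  · rintro ⟨g, h, hg, hh, hgh⟩
    obtain ⟨e, hl, hr⟩ := exists_sumLex_orderEmbedding g h hgh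
    refine ⟨e, ?_⟩
    rintro (a | a)
    · exact (hl a).symm ▸ hg a
    · exact (hr a).symm ▸ hh a

/-- In a family saturated for stacked copies of `P` and `Q`, if some copy of `Q` in the family
lies above a given copy `g` of `P`, then so does one that is separated from `g` by a member of
the family. -/
theorem exists_mem_between_of_saturated {α P Q : Type*} [Lattice α] [OrderTop α] [Finite α]
    [PartialOrder P] [PartialOrder Q] [Fintype Q]
    (hP : ¬ ∃ p : P, IsTop p) (hQ : ¬ ∃ q : Q, IsBot q) {F : Set α}
    (hno : ¬ HasStackedCopy P Q F) (hsat : ∀ S ∉ F, HasStackedCopy P Q (insert S F))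
    (g : P ↪o α) (h : Q ↪o α) (hh : ∀ q, h q ∈ F) (hgh : ∀ p q, g p < h q) :
    ∃ T ∈ F, ∃ h' : Q ↪o α, (∀ q, h' q ∈ F) ∧ (∀ p, g p < T) ∧ ∀ q, T < h' q := by
  induction hY : univ.inf h using WellFoundedGT.induction generalizing h with
  | ind Y ih =>
  subst hY
  set Y := univ.inf h with hYdef
  have hgY : ∀ p, g p ≤ Y := fun p => Finset.le_inf fun q _ => (hgh p q).le
  have hYh : ∀ q, Y ≤ h q := fun q => Finset.inf_le (mem_univ q)
  by_cases hYF : Y ∈ F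
  · refine ⟨Y, hYF, h, hh, fun p => (hgY p).lt_of_ne fun hp => hP ⟨p, fun p' => ?_⟩,
      fun q => (hYh q).lt_of_ne fun hq => hQ ⟨q, fun q' => ?_⟩⟩
    · exact g.le_iff_le.1 (hp ▸ hgY p')
    · exact h.le_iff_le.1 (hq ▸ hYh q')
  obtain ⟨g', h', hg', hh', hgh'⟩ := hsat Y hYF
  have hh'F : ∀ q, h' q ∈ F := by
    refine fun q => (hh' q).resolve_left fun hq => hno ⟨g', h, fun p => ?_, hh, fun p q' => ?_⟩
    · exact (hg' p).resolve_left (hq ▸ hgh' p q).ne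
    · exact (hq ▸ hgh' p q).trans_le (hYh q')
  obtain ⟨p₀, hp₀⟩ : ∃ p, g' p = Y := by
    by_contra! hne
    exact hno ⟨g', h', fun p => (hg' p).resolve_left (hne p), hh'F, hgh'⟩
  have hg'inf : ∀ p, g' p ≤ univ.inf h' := fun p => Finset.le_inf fun q _ => (hgh' p q).le
  have hlt : Y < univ.inf h' := by
    refine (hp₀ ▸ hg'inf p₀).lt_of_ne fun heq => hP ⟨p₀, fun p => g'.le_iff_le.1 ?_⟩
    rw [hp₀, heq]
    exact hg'inf p
  exact ih _ hlt h' hh'F (fun p q => (hgY p).trans_lt (hp₀ ▸ hgh' p₀ q)) rfl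

/-- In a family saturated for stacked copies of `P` and `Q`, adding any set creates a stacked
copy with an element strictly in between. -/
theorem exists_stacked_copy_with_middle_of_saturated {α P Q : Type*} [Lattice α] [BoundedOrder α]
    [Finite α] [PartialOrder P] [PartialOrder Q] [Fintype P] [Fintype Q]
    (hP : ¬ ∃ p : P, IsTop p) (hQ : ¬ ∃ q : Q, IsBot q) {F : Set α}
    (hno : ¬ HasStackedCopy P Q F) (hsat : ∀ S ∉ F, HasStackedCopy P Q (insert S F))
    {S : α} (hS : S ∉ F) :
    ∃ (g : P ↪o α) (T : α) (h : Q ↪o α), (∀ p, g p ∈ insert S F) ∧ T ∈ insert S F ∧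
      (∀ q, h q ∈ insert S F) ∧ (∀ p, g p < T) ∧ ∀ q, T < h q := by
  obtain ⟨g, h, hg, hh, hgh⟩ := hsat S hS
  by_cases hSh : ∃ q, h q = S
  · obtain ⟨q₀, hq₀⟩ := hSh
    have hgF : ∀ p, g p ∈ F := fun p => (hg p).resolve_left (hq₀ ▸ hgh p q₀).ne
    obtain ⟨T, hT, g', hg', hhT, hgT⟩ :=
      exists_mem_between_of_saturated (α := αᵒᵈ) (P := Qᵒᵈ) (Q := Pᵒᵈ)
        (F := OrderDual.ofDual ⁻¹' F) hQ hP (fun H => hno H.of_dual)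
        (fun S hS => (hsat (OrderDual.ofDual S) hS).dual) h.dual g.dual hgF
        (fun q p => hgh p q)
    exact ⟨OrderEmbedding.dual g', OrderDual.ofDual T, h, fun p => Or.inr (hg' p), Or.inr hT, hh,
      hgT, hhT⟩
  · push Not at hSh
    obtain ⟨T, hT, h', hh', hgT, hTh⟩ := exists_mem_between_of_saturated hP hQ hno hsat g h
      (fun q => (hh q).resolve_left (hSh q)) hgh
    exact ⟨g, T, h', hg, Or.inr hT, fun q => Or.inr (hh' q), hgT, hTh⟩

/-- If `Q₁`, `Q₂` are finite posets, not both empty, `Q₁` without a unique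
minimal element and `Q₂` without a unique maximal element, then any `Q₁*Q₂`-saturated
family of subsets of `[n]` is also `Q₁*•*Q₂`-saturated. -/
theorem statement0 {n : ℕ} (Q₁ Q₂ : Type) [PartialOrder Q₁] [PartialOrder Q₂]
    [Fintype Q₁] [Fintype Q₂]
    (hne : Nonempty Q₁ ∨ Nonempty Q₂)
    (hmin : ¬ ∃! a : Q₁, IsMin a)
    (hmax : ¬ ∃! a : Q₂, IsMax a)
    (F : Finset (Finset (Fin n)))
    (hF : IsSaturated (Q₂ ⊕ₗ Q₁) F) :
    IsSaturated (Q₂ ⊕ₗ (Unit ⊕ₗ Q₁)) F := by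
  have hP : ¬ ∃ p : Q₂, IsTop p := fun ⟨p, hp⟩ =>
    hmax ⟨p, hp.isMax, fun p' hp' => hp'.eq_of_le (hp p')⟩
  have hQ : ¬ ∃ q : Q₁, IsBot q := fun ⟨q, hq⟩ =>
    hmin ⟨q, hq.isMin, fun q' hq' => hq'.eq_of_ge (hq q')⟩
  simp only [IsSaturated, containsCopy_sumLex_iff] at hF ⊢
  obtain ⟨hno, hsat⟩ := hF
  refine ⟨fun ⟨g, h, hg, hh, hgh⟩ => hno ?_, fun S hS => ?_⟩
  · refine ⟨g, OrderEmbedding.ofMapLEIff (fun q => h (Sum.inrₗ q)) fun a b => ?_,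
      hg, fun _ => hh _, fun _ _ => hgh _ _⟩
    exact h.le_iff_le.trans Sum.Lex.inr_le_inr_iff
  · obtain ⟨g, T, h, hg, hT, hh, hgT, hTh⟩ :=
      exists_stacked_copy_with_middle_of_saturated hP hQ hno hsat hS
    obtain ⟨e, hl, hr⟩ := exists_sumLex_orderEmbedding
      (OrderEmbedding.ofMapLEIff (fun _ : Unit => T) fun _ _ => by simp) h fun _ q => hTh q
    refine ⟨g, e, hg, ?_, ?_⟩
    · rintro (a | a)
      · exact (hl a).symm ▸ hT
      · exact (hr a).symm ▸ hh a
    · rintro p (a | a)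
      · exact (hgT p).trans_eq (hl a).symm
      · exact ((hgT p).trans (hTh a)).trans_eq (hr a).symm
end

section
/- Let 𝒫₁ and 𝒫₂ be finite posets and k ≥ 2 an integer. Define 𝒫₁' = 𝒫₁ if 𝒫₁ has a unique minimal element and 𝒫₁' = 𝒫₁*• otherwise; define 𝒫₂' = 𝒫₂ if 𝒫₂ has a unique maximal element and 𝒫₂' = •*𝒫₂ otherwise. Then sat*(n, 𝒫₁*𝒜_k*𝒫₂) ≥ sat*(n, 𝒫₁'*𝒜_k*𝒫₂') for every n. -/
open Finset

/-- Order embeddings of `α` and `β`, the first strictly below the second, glue to one of the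
lexicographic sum. -/
def sumLexEmbedding {α β γ : Type} [PartialOrder α] [PartialOrder β] [PartialOrder γ]
    (f : α ↪o γ) (g : β ↪o γ) (h : ∀ a b, f a < g b) : α ⊕ₗ β ↪o γ :=
  OrderEmbedding.ofMapLEIff (fun x => Sum.elim f g (ofLex x)) <| by
    intro x y
    induction x using Lex.rec with | _ x =>
    induction y using Lex.rec with | _ y =>
    rcases x with a | b <;> rcases y with a' | b'
    · simp
    · simpa using (h a b').le
    · simpa using (h a' b).not_ge
    · simp

theorem containsCopy_iff {P : Type} [PartialOrder P] {n : ℕ} {F : Set (Finset (Fin n))} :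
    ContainsCopy P F ↔ ∃ f : P ↪o Finset (Fin n), ∀ a, f a ∈ F := by
  constructor
  · rintro ⟨f, -, hF, hle⟩
    exact ⟨OrderEmbedding.ofMapLEIff f fun a b => (hle a b).symm, hF⟩
  · rintro ⟨f, hF⟩
    exact ⟨f, f.injective, hF, fun a b => f.le_iff_le.symm⟩

theorem containsCopy_sumLex_iff_s1 {A B : Type} [PartialOrder A] [PartialOrder B] {n : ℕ}
    {F : Set (Finset (Fin n))} :
    ContainsCopy (A ⊕ₗ B) F ↔ ∃ (f : A ↪o Finset (Fin n)) (g : B ↪o Finset (Fin n)),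
      (∀ a, f a ∈ F) ∧ (∀ b, g b ∈ F) ∧ ∀ a b, f a < g b := by
  rw [containsCopy_iff]
  constructor
  · rintro ⟨f, hf⟩
    refine ⟨OrderEmbedding.ofMapLEIff (fun a => f (Sum.inlₗ a)) (by simp),
      OrderEmbedding.ofMapLEIff (fun b => f (Sum.inrₗ b)) (by simp), fun a => hf _,
      fun b => hf _, fun a b => f.lt_iff_lt.2 (Sum.Lex.inl_lt_inr a b)⟩
  · rintro ⟨f, g, hf, hg, h⟩
    refine ⟨sumLexEmbedding f g h, fun x => ?_⟩
    induction x using Lex.rec with | _ x =>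
    rcases x with a | b
    exacts [hf a, hg b]

theorem ContainsCopy.congr {P Q : Type} [PartialOrder P] [PartialOrder Q] (e : Q ≃o P) {n : ℕ}
    {F : Set (Finset (Fin n))} (h : ContainsCopy P F) : ContainsCopy Q F := by
  obtain ⟨f, hf⟩ := containsCopy_iff.1 h
  exact containsCopy_iff.2 ⟨e.toOrderEmbedding.trans f, fun a => hf _⟩

theorem IsSaturated.congr {P Q : Type} [PartialOrder P] [PartialOrder Q] (e : Q ≃o P) {n : ℕ}
    {F : Finset (Finset (Fin n))} (h : IsSaturated P F) : IsSaturated Q F :=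
  ⟨fun hc => h.1 (hc.congr e.symm), fun S hS => (h.2 S hS).congr e⟩

theorem exists_isSaturated (P : Type) [PartialOrder P] [Nonempty P] (n : ℕ) :
    ∃ F : Finset (Finset (Fin n)), IsSaturated P F := by
  have h0 : ¬ ContainsCopy P (↑(∅ : Finset (Finset (Fin n))) : Set (Finset (Fin n))) := by
    rintro ⟨f, -, hf, -⟩
    simpa using hf (Classical.arbitrary P)
  obtain ⟨F, -, hF⟩ := (Set.toFinite
    {F : Finset (Finset (Fin n)) | ¬ ContainsCopy P (↑F : Set (Finset (Fin n)))}).exists_le_maximal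
      h0
  refine ⟨F, hF.prop, fun S hS => ?_⟩
  by_contra hc
  rw [← Finset.coe_insert] at hc
  exact hS (hF.le_of_ge hc (Finset.subset_insert S F) (Finset.mem_insert_self S F))

theorem satStar_le_satStar {P Q : Type} [PartialOrder P] [PartialOrder Q] [Nonempty P] {n : ℕ}
    (h : ∀ F : Finset (Finset (Fin n)), IsSaturated P F → IsSaturated Q F) :
    satStar n Q ≤ satStar n P := by
  obtain ⟨F₀, hF₀⟩ := exists_isSaturated P n
  obtain ⟨F, hF, hcard⟩ := Nat.sInf_mem
    (⟨_, F₀, hF₀, rfl⟩ : {m | ∃ F : Finset (Finset (Fin n)), IsSaturated P F ∧ F.card = m}.Nonempty)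
  exact Nat.sInf_le ⟨F, h F hF, hcard⟩

section Interpolation

variable {L R : Type} [PartialOrder L] [PartialOrder R] {n : ℕ} {F : Finset (Finset (Fin n))}

/-- If `L` has no greatest element and a set lies below a copy of `R` in an
`L ⊕ₗ R`-saturated family, then some member of the family separates the two. -/
theorem IsSaturated.exists_mem_le_upper (hF : IsSaturated (L ⊕ₗ R) F)
    (hL : ∀ l : L, ∃ l', ¬ l' ≤ l) {U : Finset (Fin n)} (g : R ↪o Finset (Fin n))
    (hg : ∀ r, g r ∈ F) (hU : ∀ r, U ≤ g r) :
    ∃ M ∈ F, U ≤ M ∧ ∃ g : R ↪o Finset (Fin n), (∀ r, g r ∈ F) ∧ ∀ r, M ≤ g r := by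
  classical
  obtain ⟨M, hUM, hM⟩ := (Set.toFinite {M : Finset (Fin n) |
    ∃ g : R ↪o Finset (Fin n), (∀ r, g r ∈ F) ∧ ∀ r, M ≤ g r}).exists_le_maximal ⟨g, hg, hU⟩
  refine ⟨M, ?_, hUM, hM.prop⟩
  by_contra hMF
  obtain ⟨f', g', hf', hg', hlt⟩ := containsCopy_sumLex_iff_s1.1 (hF.2 M hMF)
  by_cases hl : ∃ l, f' l = M
  · obtain ⟨l, rfl⟩ := hl
    have hle : ({x | ∃ l, x ∈ f' l} : Finset (Fin n)) ≤ f' l := by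
      refine hM.le_of_ge ⟨g', fun r => (hg' r).resolve_left (hlt l r).ne', fun r x hx => ?_⟩
        fun x hx => by simpa using ⟨l, hx⟩
      obtain ⟨l', hx⟩ := (Finset.mem_filter.1 hx).2
      exact (hlt l' r).le hx
    obtain ⟨l', hl'⟩ := hL l
    exact hl' (f'.le_iff_le.1 fun x hx => hle (by simpa using ⟨l', hx⟩))
  · have hfF : ∀ l, f' l ∈ F := fun l => (hf' l).resolve_left fun h => hl ⟨l, h⟩
    by_cases hr : ∃ r, g' r = M
    · obtain ⟨r, rfl⟩ := hr
      obtain ⟨g, hg, hMg⟩ := hM.prop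
      exact hF.1 (containsCopy_sumLex_iff_s1.2
        ⟨f', g, hfF, hg, fun l r' => (hlt l r).trans_le (hMg r')⟩)
    · exact hF.1 (containsCopy_sumLex_iff_s1.2
        ⟨f', g', hfF, fun r => (hg' r).resolve_left fun h => hr ⟨r, h⟩, hlt⟩)

/-- If `R` has no least element and a set lies above a copy of `L` in an
`L ⊕ₗ R`-saturated family, then some member of the family separates the two. -/
theorem IsSaturated.exists_mem_ge_lower (hF : IsSaturated (L ⊕ₗ R) F)
    (hR : ∀ r : R, ∃ r', ¬ r ≤ r') {V : Finset (Fin n)} (f : L ↪o Finset (Fin n))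
    (hf : ∀ l, f l ∈ F) (hV : ∀ l, f l ≤ V) :
    ∃ M ∈ F, M ≤ V ∧ ∃ f : L ↪o Finset (Fin n), (∀ l, f l ∈ F) ∧ ∀ l, f l ≤ M := by
  classical
  obtain ⟨M, hMV, hM⟩ := (Set.toFinite {M : Finset (Fin n) |
    ∃ f : L ↪o Finset (Fin n), (∀ l, f l ∈ F) ∧ ∀ l, f l ≤ M}).exists_le_minimal ⟨f, hf, hV⟩
  refine ⟨M, ?_, hMV, hM.prop⟩
  by_contra hMF
  obtain ⟨f', g', hf', hg', hlt⟩ := containsCopy_sumLex_iff_s1.1 (hF.2 M hMF)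
  by_cases hr : ∃ r, g' r = M
  · obtain ⟨r, rfl⟩ := hr
    have hle : g' r ≤ ({x | ∀ r, x ∈ g' r} : Finset (Fin n)) := by
      refine hM.le_of_le ⟨f', fun l => (hf' l).resolve_left (hlt l r).ne, fun l x hx => ?_⟩
        fun x hx => (Finset.mem_filter.1 hx).2 r
      simpa using fun r' => (hlt l r').le hx
    obtain ⟨r', hr'⟩ := hR r
    exact hr' (g'.le_iff_le.1 fun x hx => (Finset.mem_filter.1 (hle hx)).2 r')
  · have hgF : ∀ r, g' r ∈ F := fun r => (hg' r).resolve_left fun h => hr ⟨r, h⟩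
    by_cases hl : ∃ l, f' l = M
    · obtain ⟨l, rfl⟩ := hl
      obtain ⟨f, hf, hfM⟩ := hM.prop
      exact hF.1 (containsCopy_sumLex_iff_s1.2
        ⟨f, g', hf, hgF, fun l' r => (hfM l').trans_lt (hlt l r)⟩)
    · exact hF.1 (containsCopy_sumLex_iff_s1.2
        ⟨f', g', fun l => (hf' l).resolve_left fun h => hl ⟨l, h⟩, hgF, hlt⟩)

theorem containsCopy_sumLex_unit_sumLex {G : Set (Finset (Fin n))}
    (hL : ∀ l : L, ∃ l', ¬ l' ≤ l) (hR : ∀ r : R, ∃ r', ¬ r ≤ r')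
    (f : L ↪o Finset (Fin n)) (g : R ↪o Finset (Fin n)) {M : Finset (Fin n)}
    (hf : ∀ l, f l ∈ G) (hg : ∀ r, g r ∈ G) (hMG : M ∈ G)
    (hfM : ∀ l, f l ≤ M) (hMg : ∀ r, M ≤ g r) :
    ContainsCopy (L ⊕ₗ (Unit ⊕ₗ R)) G := by
  have hfM' : ∀ l, f l < M := fun l => (hfM l).lt_of_ne fun h => by
    obtain ⟨l', hl'⟩ := hL l
    exact hl' (f.le_iff_le.1 (h ▸ hfM l'))
  have hMg' : ∀ r, M < g r := fun r => (hMg r).lt_of_ne fun h => by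
    obtain ⟨r', hr'⟩ := hR r
    exact hr' (g.le_iff_le.1 (h ▸ hMg r'))
  refine containsCopy_sumLex_iff_s1.2 ⟨f, sumLexEmbedding
    (OrderEmbedding.ofMapLEIff (fun _ : Unit => M) (by simp)) g fun _ => hMg', hf, ?_, ?_⟩
  · intro x
    induction x using Lex.rec with | _ x =>
    rcases x with u | r
    exacts [hMG, hg r]
  · intro l x
    induction x using Lex.rec with | _ x =>
    rcases x with u | r
    exacts [hfM' l, (hfM' l).trans (hMg' r)]

/-- A point may be inserted between `L` and `R` if `L` has no greatest and `R` no least element. -/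
theorem IsSaturated.insert_unit (hF : IsSaturated (L ⊕ₗ R) F)
    (hL : ∀ l : L, ∃ l', ¬ l' ≤ l) (hR : ∀ r : R, ∃ r', ¬ r ≤ r') :
    IsSaturated (L ⊕ₗ (Unit ⊕ₗ R)) F := by
  classical
  constructor
  · intro h
    obtain ⟨f, g, hf, hg, hlt⟩ := containsCopy_sumLex_iff_s1.1 h
    exact hF.1 (containsCopy_sumLex_iff_s1.2 ⟨f,
      OrderEmbedding.ofMapLEIff (fun r => g (Sum.inrₗ r)) (by simp), hf, fun r => hg _,
      fun l r => hlt l _⟩)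
  · intro S hS
    obtain ⟨f, g, hf, hg, hlt⟩ := containsCopy_sumLex_iff_s1.1 (hF.2 S hS)
    by_cases hr : ∃ r, g r = S
    · obtain ⟨r, rfl⟩ := hr
      obtain ⟨M, hM, hMV, f', hf', hfM⟩ := hF.exists_mem_ge_lower hR
        (V := {x | ∀ r, x ∈ g r}) f (fun l => (hf l).resolve_left (hlt l r).ne)
        fun l x hx => by simpa using fun r' => (hlt l r').le hx
      exact containsCopy_sumLex_unit_sumLex hL hR f' g (fun l => Or.inr (hf' l)) hg (Or.inr hM)
        hfM fun r' x hx => (Finset.mem_filter.1 (hMV hx)).2 r'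
    · obtain ⟨M, hM, hUM, g', hg', hMg⟩ := hF.exists_mem_le_upper hL
        (U := {x | ∃ l, x ∈ f l}) g (fun r => (hg r).resolve_left fun h => hr ⟨r, h⟩)
        fun r x hx => by
          obtain ⟨l, hl⟩ := (Finset.mem_filter.1 hx).2
          exact (hlt l r).le hl
      exact containsCopy_sumLex_unit_sumLex hL hR f g' hf (fun r => Or.inr (hg' r)) (Or.inr hM)
        (fun l x hx => hUM (by simpa using ⟨l, hx⟩)) hMg

end Interpolation

theorem exists_not_le_of_not_existsUnique_isMin {P : Type} [PartialOrder P]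
    (h : ¬ ∃! a : P, IsMin a) (a : P) : ∃ b, ¬ a ≤ b := by
  by_contra! hc
  exact h ⟨a, fun b _ => hc b, fun b hb => hb.eq_of_ge (hc b)⟩

theorem exists_not_ge_of_not_existsUnique_isMax {P : Type} [PartialOrder P]
    (h : ¬ ∃! a : P, IsMax a) (a : P) : ∃ b, ¬ b ≤ a := by
  by_contra! hc
  exact h ⟨a, fun b _ => hc b, fun b hb => hb.eq_of_le (hc b)⟩

theorem AC.exists_ne {k : ℕ} (hk : 2 ≤ k) (a : AC k) : ∃ b : AC k, b ≠ a :=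
  have : Nontrivial (Fin k) := Fin.nontrivial_iff_two_le.2 hk
  _root_.exists_ne (α := Fin k) a

theorem sumLex_AC_no_top {k : ℕ} (hk : 2 ≤ k) {P : Type} [PartialOrder P] (l : P ⊕ₗ AC k) :
    ∃ l', ¬ l' ≤ l := by
  induction l using Lex.rec with | _ l =>
  rcases l with p | a
  · exact ⟨Sum.inrₗ ⟨0, by omega⟩, Sum.Lex.not_inr_le_inl⟩
  · obtain ⟨b, hb⟩ := AC.exists_ne hk a
    exact ⟨Sum.inrₗ b, fun h => hb (Sum.Lex.inr_le_inr_iff.1 h)⟩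

theorem AC_sumLex_no_bot {k : ℕ} (hk : 2 ≤ k) {P : Type} [PartialOrder P] (r : AC k ⊕ₗ P) :
    ∃ r', ¬ r ≤ r' := by
  induction r using Lex.rec with | _ r =>
  rcases r with a | p
  · obtain ⟨b, hb⟩ := AC.exists_ne hk a
    exact ⟨Sum.inlₗ b, fun h => hb (Sum.Lex.inl_le_inl_iff.1 h).symm⟩
  · exact ⟨Sum.inlₗ ⟨0, by omega⟩, Sum.Lex.not_inr_le_inl⟩

/-- with `P₁' = P₁` if `P₁` has a unique minimal element and `P₁' = P₁*•`
otherwise, and `P₂' = P₂` if `P₂` has a unique maximal element and `P₂' = •*P₂`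
otherwise, `sat*(n, P₁*𝒜_k*P₂) ≥ sat*(n, P₁'*𝒜_k*P₂')`. Here `Q₁`, `Q₂` play the roles
of `P₁'`, `P₂'`, specified up to order isomorphism. -/
theorem statement1 (P₁ P₂ Q₁ Q₂ : Type) [PartialOrder P₁] [PartialOrder P₂]
    [PartialOrder Q₁] [PartialOrder Q₂]
    [Fintype P₁] [Fintype P₂] [Fintype Q₁] [Fintype Q₂]
    (k : ℕ) (hk : 2 ≤ k)
    (hQ₁a : (∃! a : P₁, IsMin a) → Nonempty (Q₁ ≃o P₁))
    (hQ₁b : ¬ (∃! a : P₁, IsMin a) → Nonempty (Q₁ ≃o (Unit ⊕ₗ P₁)))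
    (hQ₂a : (∃! a : P₂, IsMax a) → Nonempty (Q₂ ≃o P₂))
    (hQ₂b : ¬ (∃! a : P₂, IsMax a) → Nonempty (Q₂ ≃o (P₂ ⊕ₗ Unit)))
    (n : ℕ) :
    satStar n (Q₂ ⊕ₗ (AC k ⊕ₗ Q₁)) ≤ satStar n (P₂ ⊕ₗ (AC k ⊕ₗ P₁)) := by
  have : Nonempty (P₂ ⊕ₗ (AC k ⊕ₗ P₁)) := ⟨Sum.inrₗ (Sum.inlₗ ⟨0, by omega⟩)⟩
  refine satStar_le_satStar fun F hF => ?_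
  have hF₁ : IsSaturated (P₂ ⊕ₗ (AC k ⊕ₗ Q₁)) F := by
    by_cases h : ∃! a : P₁, IsMin a
    · obtain ⟨e⟩ := hQ₁a h
      exact hF.congr (OrderIso.sumLexCongr (.refl _) (OrderIso.sumLexCongr (.refl _) e))
    · obtain ⟨e⟩ := hQ₁b h
      exact ((hF.congr (OrderIso.sumLexAssoc _ _ _)).insert_unit (sumLex_AC_no_top hk)
        (exists_not_le_of_not_existsUnique_isMin h)).congr
          ((OrderIso.sumLexCongr (.refl _) (OrderIso.sumLexCongr (.refl _) e)).trans
            (OrderIso.sumLexAssoc _ _ _).symm)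
  by_cases h : ∃! a : P₂, IsMax a
  · obtain ⟨e⟩ := hQ₂a h
    exact hF₁.congr (OrderIso.sumLexCongr e (.refl _))
  · obtain ⟨e⟩ := hQ₂b h
    exact (hF₁.insert_unit (exists_not_ge_of_not_existsUnique_isMax h)
      (AC_sumLex_no_bot hk)).congr
        ((OrderIso.sumLexCongr e (.refl _)).trans (OrderIso.sumLexAssoc _ _ _))
end

section
/- Suppose |ℱ| < n. Then for every i ∈ [n], at least one of the following holds: (1) i ∈ M for some M ∈ ℳ; (2) there exists Y ∈ ℱ with i ∉ Y such that M ⊊ Y ⊊ N for some M ∈ ℳ and N ∈ 𝒩; (3) there exists a set S ⊆ [n] with i ∉ S such that both S ∈ ℱ and S ∪ {i} ∈ ℱ. -/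
open Finset

/-- `ℳ₀`: members of `F` whose down-set in `F` contains an induced copy of `P₂`. -/
def Mzero (P₂ : Type) [PartialOrder P₂] {n : ℕ} (F : Finset (Finset (Fin n))) :
    Set (Finset (Fin n)) :=
  {A | A ∈ F ∧ ContainsCopy P₂ {X | X ∈ F ∧ X ⊆ A}}

/-- `ℳ`: the minimal elements of `ℳ₀`. -/
def Mfam (P₂ : Type) [PartialOrder P₂] {n : ℕ} (F : Finset (Finset (Fin n))) :
    Set (Finset (Fin n)) :=
  {A ∈ Mzero P₂ F | ∀ B ∈ Mzero P₂ F, B ⊆ A → B = A}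

/-- `𝒩₀`: members of `F` whose up-set in `F` contains an induced copy of `P₁`. -/
def Nzero (P₁ : Type) [PartialOrder P₁] {n : ℕ} (F : Finset (Finset (Fin n))) :
    Set (Finset (Fin n)) :=
  {A | A ∈ F ∧ ContainsCopy P₁ {X | X ∈ F ∧ A ⊆ X}}

/-- `𝒩`: the maximal elements of `𝒩₀`. -/
def Nfam (P₁ : Type) [PartialOrder P₁] {n : ℕ} (F : Finset (Finset (Fin n))) :
    Set (Finset (Fin n)) :=
  {A ∈ Nzero P₁ F | ∀ B ∈ Nzero P₁ F, A ⊆ B → A = B}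

theorem IsMax.isTop_of_forall_eq {P : Type*} [PartialOrder P] [Finite P] {t : P}
    (ht : ∀ x : P, IsMax x → x = t) : IsTop t := by
  intro x
  obtain ⟨m, hxm, hm⟩ := Set.toFinite (Set.univ : Set P) |>.exists_le_maximal (Set.mem_univ x)
  rw [← ht m fun y hy => hm.2 (Set.mem_univ y) hy]
  exact hxm

theorem IsMin.isBot_of_forall_eq {P : Type*} [PartialOrder P] [Finite P] {b : P}
    (hb : ∀ x : P, IsMin x → x = b) : IsBot b := by
  intro x
  obtain ⟨m, hmx, hm⟩ := Set.toFinite (Set.univ : Set P) |>.exists_le_minimal (Set.mem_univ x)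
  rw [← hb m fun y hy => hm.2 (Set.mem_univ y) hy]
  exact hmx

section

variable {n k : ℕ} {P₁ P₂ : Type} [PartialOrder P₁] [PartialOrder P₂]
  {F : Finset (Finset (Fin n))}

/-- An order embedding of `P₂ ⊕ₗ (AC k ⊕ₗ P₁)` into the Boolean lattice, given by its three
layers. -/
structure LayeredCopy (P₁ P₂ : Type) [PartialOrder P₁] [PartialOrder P₂] (k n : ℕ) where
  lower : P₂ → Finset (Fin n)
  middle : Fin k → Finset (Fin n)
  upper : P₁ → Finset (Fin n)
  lower_le : ∀ x y, x ≤ y ↔ lower x ⊆ lower y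
  middle_le : ∀ x y, x = y ↔ middle x ⊆ middle y
  upper_le : ∀ x y, x ≤ y ↔ upper x ⊆ upper y
  lower_lt_middle : ∀ x y, lower x ⊂ middle y
  middle_lt_upper : ∀ x y, middle x ⊂ upper y

theorem LayeredCopy.containsCopy (c : LayeredCopy P₁ P₂ k n) (hk : 0 < k)
    {G : Set (Finset (Fin n))} (hl : ∀ x, c.lower x ∈ G) (hm : ∀ x, c.middle x ∈ G)
    (hu : ∀ x, c.upper x ∈ G) : ContainsCopy (P₂ ⊕ₗ (AC k ⊕ₗ P₁)) G := by
  let f : P₂ ⊕ₗ (AC k ⊕ₗ P₁) → Finset (Fin n) := fun p =>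
    Sum.elim c.lower (fun q => Sum.elim c.middle c.upper (ofLex q)) (ofLex p)
  have hlu : ∀ x y, c.lower x ⊂ c.upper y := fun x y =>
    (c.lower_lt_middle x ⟨0, hk⟩).trans (c.middle_lt_upper _ y)
  have hf : ∀ a b, a ≤ b ↔ f a ⊆ f b := by
    rintro (a | a | a) (b | b | b)
    · exact Sum.Lex.inl_le_inl_iff.trans (c.lower_le a b)
    · exact iff_of_true (Sum.Lex.inl_le_inr _ _) (c.lower_lt_middle a b).subset
    · exact iff_of_true (Sum.Lex.inl_le_inr _ _) (hlu a b).subset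
    · exact iff_of_false Sum.Lex.not_inr_le_inl (c.lower_lt_middle b a).not_subset
    · exact Sum.Lex.inr_le_inr_iff.trans (Sum.Lex.inl_le_inl_iff.trans (c.middle_le a b))
    · exact iff_of_true (Sum.Lex.inr_le_inr_iff.2 (Sum.Lex.inl_le_inr _ _))
        (c.middle_lt_upper a b).subset
    · exact iff_of_false Sum.Lex.not_inr_le_inl (hlu b a).not_subset
    · exact iff_of_false (fun h => Sum.Lex.not_inr_le_inl (Sum.Lex.inr_le_inr_iff.1 h))
        (c.middle_lt_upper b a).not_subset
    · exact Sum.Lex.inr_le_inr_iff.trans (Sum.Lex.inr_le_inr_iff.trans (c.upper_le a b))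
  refine ⟨f, fun a b hab => le_antisymm ((hf a b).2 hab.subset) ((hf b a).2 hab.superset), ?_, hf⟩
  rintro (a | a | a)
  exacts [hl a, hm a, hu a]

theorem ContainsCopy.exists_layeredCopy {G : Set (Finset (Fin n))}
    (h : ContainsCopy (P₂ ⊕ₗ (AC k ⊕ₗ P₁)) G) :
    ∃ c : LayeredCopy P₁ P₂ k n,
      (∀ x, c.lower x ∈ G) ∧ (∀ x, c.middle x ∈ G) ∧ ∀ x, c.upper x ∈ G := by
  obtain ⟨f, -, hG, hf⟩ := h
  have hlt : ∀ a b, a < b → f a ⊂ f b := fun a b hab =>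
    ⟨(hf a b).1 hab.le, fun h => hab.not_ge ((hf b a).2 h)⟩
  have hm (x y : AC k) :
      x ≤ y ↔ f (Sum.inrₗ (Sum.inlₗ x)) ⊆ f (Sum.inrₗ (Sum.inlₗ y)) :=
    (Sum.Lex.inr_le_inr_iff.trans Sum.Lex.inl_le_inl_iff).symm.trans (hf _ _)
  exact ⟨{ lower := fun x => f (Sum.inlₗ x)
           middle := fun x => f (Sum.inrₗ (Sum.inlₗ (x : AC k)))
           upper := fun x => f (Sum.inrₗ (Sum.inrₗ x))
           lower_le := fun x y => Sum.Lex.inl_le_inl_iff.symm.trans (hf _ _)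
           middle_le := hm
           upper_le := fun x y =>
             (Sum.Lex.inr_le_inr_iff.trans Sum.Lex.inr_le_inr_iff).symm.trans (hf _ _)
           lower_lt_middle := fun x y => hlt _ _ (Sum.Lex.inl_lt_inr _ _)
           middle_lt_upper := fun x y =>
             hlt _ _ (Sum.Lex.inr_lt_inr_iff.2 (Sum.Lex.inl_lt_inr _ _)) },
    fun x => hG _, fun x => hG _, fun x => hG _⟩

/-- Adding a set `S ∉ F` to a saturated family creates a copy in which `S` lies in exactly one
of the three layers. -/
theorem IsSaturated.exists_layeredCopy (hk : 0 < k)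
    (hF : IsSaturated (P₂ ⊕ₗ (AC k ⊕ₗ P₁)) F) {S : Finset (Fin n)} (hS : S ∉ F) :
    ∃ c : LayeredCopy P₁ P₂ k n,
      ((∃ x, c.lower x = S) ∧ (∀ x, c.middle x ∈ F) ∧ ∀ x, c.upper x ∈ F) ∨
      ((∀ x, c.lower x ∈ F) ∧ (∃ x, c.middle x = S ∧ ∀ y ≠ x, c.middle y ∈ F) ∧
        ∀ x, c.upper x ∈ F) ∨
      ((∀ x, c.lower x ∈ F) ∧ (∀ x, c.middle x ∈ F) ∧ ∃ x, c.upper x = S) := by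
  obtain ⟨c, hl, hm, hu⟩ := (hF.2 S hS).exists_layeredCopy
  have hlu : ∀ x y, c.lower x ⊂ c.upper y := fun x y =>
    (c.lower_lt_middle x ⟨0, hk⟩).trans (c.middle_lt_upper _ y)
  have mem : ∀ {X}, X ∈ insert S (F : Set (Finset (Fin n))) → X ≠ S → X ∈ F := fun h hne =>
    (Set.mem_insert_iff.1 h).resolve_left hne
  refine ⟨c, ?_⟩
  by_cases h₁ : ∃ x, c.lower x = S
  · obtain ⟨x, rfl⟩ := h₁
    exact .inl ⟨⟨x, rfl⟩, fun y => mem (hm y) (c.lower_lt_middle x y).ne',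
      fun y => mem (hu y) (hlu x y).ne'⟩
  have h₁' : ∀ x, c.lower x ∈ F := fun x => mem (hl x) fun h => h₁ ⟨x, h⟩
  by_cases h₂ : ∃ x, c.middle x = S
  · obtain ⟨x, rfl⟩ := h₂
    exact .inr (.inl ⟨h₁', ⟨x, rfl, fun y hy => mem (hm y) fun h =>
      hy ((c.middle_le y x).2 h.subset)⟩, fun y => mem (hu y) (c.middle_lt_upper x y).ne'⟩)
  have h₂' : ∀ x, c.middle x ∈ F := fun x => mem (hm x) fun h => h₂ ⟨x, h⟩
  refine .inr (.inr ⟨h₁', h₂', ?_⟩)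
  by_contra h₃
  exact hF.1 (c.containsCopy hk h₁' h₂' fun x => mem (hu x) fun h => h₃ ⟨x, h⟩)

theorem exists_mem_Mfam_subset {A : Finset (Fin n)} (hA : A ∈ Mzero P₂ F) :
    ∃ M ∈ Mfam P₂ F, M ⊆ A := by
  obtain ⟨M, hMA, hM⟩ := (Set.toFinite (Mzero P₂ F)).exists_le_minimal hA
  exact ⟨M, ⟨hM.1, fun B hB hBM => hBM.antisymm (hM.2 hB hBM)⟩, hMA⟩

theorem exists_mem_Nfam_superset {A : Finset (Fin n)} (hA : A ∈ Nzero P₁ F) :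
    ∃ N ∈ Nfam P₁ F, A ⊆ N := by
  obtain ⟨N, hAN, hN⟩ := (Set.toFinite (Nzero P₁ F)).exists_le_maximal hA
  exact ⟨N, ⟨hN.1, fun B hB hNB => hNB.antisymm (hN.2 hB hNB)⟩, hAN⟩

theorem LayeredCopy.mem_Mzero (c : LayeredCopy P₁ P₂ k n) (hl : ∀ x, c.lower x ∈ F)
    {A : Finset (Fin n)} (hA : A ∈ F) (h : ∀ x, c.lower x ⊆ A) : A ∈ Mzero P₂ F :=
  ⟨hA, c.lower, fun x y hxy => le_antisymm ((c.lower_le x y).2 hxy.subset)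
    ((c.lower_le y x).2 hxy.superset), fun x => ⟨hl x, h x⟩, c.lower_le⟩

theorem LayeredCopy.mem_Nzero (c : LayeredCopy P₁ P₂ k n) (hu : ∀ x, c.upper x ∈ F)
    {A : Finset (Fin n)} (hA : A ∈ F) (h : ∀ x, A ⊆ c.upper x) : A ∈ Nzero P₁ F :=
  ⟨hA, c.upper, fun x y hxy => le_antisymm ((c.upper_le x y).2 hxy.subset)
    ((c.upper_le y x).2 hxy.superset), fun x => ⟨hu x, h x⟩, c.upper_le⟩

/-- If no member of a saturated family lies above a copy of `P₂`, then every new set must be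
placed in the lowest layer, so it lies strictly below an antichain. -/
theorem IsSaturated.exists_ssubset_of_Mzero_eq_empty (hk : 2 ≤ k) {t : P₂} (ht : IsTop t)
    (hF : IsSaturated (P₂ ⊕ₗ (AC k ⊕ₗ P₁)) F) (hM : Mzero P₂ F = ∅)
    {S : Finset (Fin n)} (hS : S ∉ F) :
    ∃ A B : Finset (Fin n), S ⊂ A ∧ S ⊂ B ∧ A ≠ B := by
  obtain ⟨c, ⟨⟨x, rfl⟩, -, -⟩ | ⟨hl, -⟩ | ⟨hl, -⟩⟩ := hF.exists_layeredCopy (by lia) hS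
  · refine ⟨_, _, c.lower_lt_middle x ⟨0, by lia⟩, c.lower_lt_middle x ⟨1, by lia⟩, fun h => ?_⟩
    simpa using (c.middle_le _ _).2 h.subset
  all_goals
    have := c.mem_Mzero hl (hl t) fun x => (c.lower_le x t).1 (ht x)
    simp [hM] at this

theorem IsSaturated.Mzero_nonempty (hk : 2 ≤ k) {t : P₂} (ht : IsTop t)
    (hF : IsSaturated (P₂ ⊕ₗ (AC k ⊕ₗ P₁)) F) {i : Fin n}
    (hi : ¬∃ S : Finset (Fin n), i ∉ S ∧ S ∈ F ∧ insert i S ∈ F) :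
    (Mzero P₂ F).Nonempty := by
  by_contra hM
  rw [Set.not_nonempty_iff_eq_empty] at hM
  refine hi ⟨univ.erase i, notMem_erase i univ, ?_, ?_⟩
  · by_contra hS
    obtain ⟨A, B, hA, hB, hAB⟩ := hF.exists_ssubset_of_Mzero_eq_empty hk ht hM hS
    have key : ∀ {X : Finset (Fin n)}, univ.erase i ⊂ X → X = univ := fun {X} hX => by
      obtain ⟨j, hjX, hj⟩ := Finset.exists_of_ssubset hX
      have hji : j = i := by simpa using hj
      subst hji
      exact univ_subset_iff.1 (by simpa [insert_subset_iff, hjX] using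
        (insert_subset hjX hX.subset : insert j (univ.erase j) ⊆ X))
    exact hAB ((key hA).trans (key hB).symm)
  · by_contra hS
    obtain ⟨A, -, hA, -⟩ := hF.exists_ssubset_of_Mzero_eq_empty hk ht hM hS
    rw [insert_erase (mem_univ i)] at hA
    exact hA.not_subset (subset_univ A)

end

/-- Lemma: first preliminary lemma. -/
theorem statement2 {n : ℕ} (P₁ P₂ : Type) [PartialOrder P₁] [PartialOrder P₂]
    [Fintype P₁] [Fintype P₂]
    (k : ℕ) (hk : 2 ≤ k)
    (hP₁ : ∃! a : P₁, IsMin a) (hP₂ : ∃! a : P₂, IsMax a)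
    (F : Finset (Finset (Fin n)))
    (hF : IsSaturated (P₂ ⊕ₗ (AC k ⊕ₗ P₁)) F)
    (hcard : F.card < n) (i : Fin n) :
    (∃ M ∈ Mfam P₂ F, i ∈ M) ∨
    (∃ Y ∈ F, i ∉ Y ∧ ∃ M ∈ Mfam P₂ F, ∃ N ∈ Nfam P₁ F, M ⊂ Y ∧ Y ⊂ N) ∨
    (∃ S : Finset (Fin n), i ∉ S ∧ S ∈ F ∧ insert i S ∈ F) := by
  obtain ⟨b, -, hb⟩ := hP₁
  obtain ⟨t, -, ht⟩ := hP₂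
  replace hb : IsBot b := IsMin.isBot_of_forall_eq hb
  replace ht : IsTop t := IsMax.isTop_of_forall_eq ht
  refine or_iff_not_imp_left.2 fun h₁ => or_iff_not_imp_right.2 fun h₃ => ?_
  obtain ⟨A, hA⟩ := hF.Mzero_nonempty hk ht h₃
  obtain ⟨M, hM, -⟩ := exists_mem_Mfam_subset hA
  have hiM : ∀ {M}, M ∈ Mfam P₂ F → i ∉ M := fun hM hi => h₁ ⟨_, hM, hi⟩
  have hS : insert i M ∉ F := fun h => h₃ ⟨M, hiM hM, hM.1.1, h⟩
  have eq_M : ∀ {X}, X ∈ Mzero P₂ F → X ⊂ insert i M → X = M := by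
    intro X hX hXS
    obtain ⟨M', hM', hM'X⟩ := exists_mem_Mfam_subset hX
    have hM'M : M' = M := hM.2 M' hM'.1
      ((subset_insert_iff_of_notMem (hiM hM')).1 (hM'X.trans hXS.subset))
    subst hM'M
    refine (hM'X.antisymm fun x hx => ?_).symm
    obtain rfl | hx' := mem_insert.1 (hXS.subset hx)
    · exact absurd (insert_subset hx hM'X) hXS.not_subset
    · exact hx'
  obtain ⟨c, ⟨⟨x, hx⟩, hm, hu⟩ | ⟨hl, ⟨x, hx, hm⟩, hu⟩ | ⟨hl, hm, x, hx⟩⟩ :=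
    hF.exists_layeredCopy (by lia) hS
  · obtain ⟨-, g, -, hgF, hg⟩ := hM.1
    have hlt : ∀ y z, g y ⊂ c.middle z := fun y z =>
      ((hgF y).2.trans (subset_insert i M)).trans_ssubset (hx ▸ c.lower_lt_middle x z)
    exact absurd (LayeredCopy.containsCopy
      { c with lower := g, lower_le := hg, lower_lt_middle := hlt } (by lia)
      (fun y => (hgF y).1) hm hu) hF.1
  · have htM : c.lower t = M := eq_M (c.mem_Mzero hl (hl t) fun y => (c.lower_le y t).1 (ht y))
      (hx ▸ c.lower_lt_middle t x)
    have : Nontrivial (Fin k) := Fin.nontrivial_iff_two_le.2 hk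
    obtain ⟨y, hy⟩ := exists_ne x
    have hMy : M ⊂ c.middle y := htM ▸ c.lower_lt_middle t y
    obtain ⟨N, hN, hbN⟩ := exists_mem_Nfam_superset
      (c.mem_Nzero hu (hu b) fun z => (c.upper_le b z).1 (hb z))
    exact ⟨c.middle y, hm y hy, fun hi => hy.symm ((c.middle_le x y).2
      (hx ▸ insert_subset hi hMy.subset)), M, hM, N, hN, hMy,
      (c.middle_lt_upper y b).trans_subset hbN⟩
  · have hmid : ∀ y, c.middle y = M := fun y =>
      eq_M (c.mem_Mzero hl (hm y) fun z => (c.lower_lt_middle z y).subset)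
        (hx ▸ c.middle_lt_upper y x)
    have := (c.middle_le ⟨0, by lia⟩ ⟨1, by lia⟩).2 ((hmid _).trans (hmid _).symm).subset
    simp at this
end

section
/- Let ℱ be a nonempty finite family of subsets of [n], and let C = {i ∈ [n] : there exists W ⊆ [n] with i ∉ W such that W ∈ ℱ and W ∪ {i} ∈ ℱ}. Then |C| ≤ |ℱ| − 1. -/
open Finset

/-- If every `i ∈ C` is witnessed by a pair `W, insert i W` of distinct members of `F`, then `F`
has more members than `C`. The induction on `C` deletes one coordinate from all members of `F`. -/
theorem card_lt_card_of_forall_exists_insert_mem {α : Type*} [DecidableEq α] (C : Finset α)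
    {F : Finset (Finset α)} (hF : F.Nonempty)
    (hC : ∀ i ∈ C, ∃ W : Finset α, i ∉ W ∧ W ∈ F ∧ insert i W ∈ F) :
    C.card < F.card := by
  induction C using Finset.induction_on generalizing F with
  | empty => simpa using hF
  | insert i C hi ih =>
    have h_image : C.card < (F.image fun W => W.erase i).card := by
      refine ih (hF.image _) fun j hj => ?_
      obtain ⟨W, hjW, hW, hW'⟩ := hC j (mem_insert_of_mem hj)
      refine ⟨W.erase i, fun h => hjW (mem_of_mem_erase h), mem_image_of_mem _ hW, ?_⟩
      have hji : i ≠ j := fun h => hi (h ▸ hj)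
      rw [← erase_insert_of_ne hji.symm]
      exact mem_image_of_mem _ hW'
    obtain ⟨W, hiW, hW, hW'⟩ := hC i (mem_insert_self i C)
    have h_lt : (F.image fun W => W.erase i).card < F.card := by
      refine card_image_le.lt_of_ne fun h => hiW ?_
      have h_eq : W = insert i W :=
        card_image_iff.mp h hW hW' (by simp [erase_eq_of_notMem hiW, erase_insert hiW])
      rw [h_eq]
      exact mem_insert_self i W
    rw [card_insert_of_notMem hi]
    omega

/-- for a nonempty family `F` of subsets of `[n]`, the set of coordinates
`i` for which some `W ∈ F` satisfies `i ∉ W` and `W ∪ {i} ∈ F` has size at most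
`|F| - 1`. -/
theorem statement5 {n : ℕ} (F : Finset (Finset (Fin n))) (hF : F.Nonempty) :
    {i : Fin n | ∃ W : Finset (Fin n), i ∉ W ∧ W ∈ F ∧ insert i W ∈ F}.ncard
      ≤ F.card - 1 := by
  classical
  rw [Set.ncard_eq_toFinset_card']
  refine Nat.le_sub_one_of_lt (card_lt_card_of_forall_exists_insert_mem _ hF fun i hi => ?_)
  simpa using hi
end

section
/- The families ℒ and 𝒩 are disjoint, and ℒ ∪ 𝒩 contains no induced copy of C₂; that is, no member of ℒ ∪ 𝒩 is strictly contained in another member of ℒ ∪ 𝒩. -/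
open Finset

/-- Sets `X` such that some `𝒮 ⊆ I` makes `𝒮 ∪ {X}` an induced copy of `•*𝒜_k*P₂`
with `X` as its (unique) maximal element. -/
def Lzero (P₂ : Type) [PartialOrder P₂] (k : ℕ) {n : ℕ}
    (I : Set (Finset (Fin n))) : Set (Finset (Fin n)) :=
  {X | ∃ f : (P₂ ⊕ₗ (AC k ⊕ₗ Unit)) → Finset (Fin n),
      Function.Injective f ∧ (∀ a b, a ≤ b ↔ f a ⊆ f b) ∧
      f (toLex (Sum.inr (toLex (Sum.inr Unit.unit)))) = X ∧
      ∀ a, a ≠ toLex (Sum.inr (toLex (Sum.inr Unit.unit))) → f a ∈ I}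

/-- `ℒ₁`: the minimal elements of `ℒ₀`. -/
def Lone (P₂ : Type) [PartialOrder P₂] (k : ℕ) {n : ℕ}
    (F : Finset (Finset (Fin n))) : Set (Finset (Fin n)) :=
  {X ∈ Lzero P₂ k (↑F : Set (Finset (Fin n))) |
    ∀ Y ∈ Lzero P₂ k (↑F : Set (Finset (Fin n))), Y ⊆ X → Y = X}

/-- `ℒ`: members of `ℒ₁` containing no member of `𝒩`. -/
def Lfam (P₁ P₂ : Type) [PartialOrder P₁] [PartialOrder P₂] (k : ℕ) {n : ℕ}
    (F : Finset (Finset (Fin n))) : Set (Finset (Fin n)) :=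
  {X ∈ Lone P₂ k F | ∀ N ∈ Nfam P₁ F, ¬ N ⊆ X}

/-- A copy of `•*𝒜_k*P₂` with top `A` and a copy of `P₁` above some `B ⊇ A` glue to a copy of
`P₁*𝒜_k*P₂`, whose members avoid `A`. -/
lemma containsCopy_of_mem_Lzero {n k : ℕ} {P₁ P₂ : Type} [PartialOrder P₁] [PartialOrder P₂]
    {F : Set (Finset (Fin n))} {A B : Finset (Fin n)} (hA : A ∈ Lzero P₂ k F) (hAB : A ⊆ B)
    (hB : ContainsCopy P₁ {X | X ∈ F ∧ B ⊆ X}) :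
    ContainsCopy (P₂ ⊕ₗ (AC k ⊕ₗ P₁)) F := by
  obtain ⟨f, -, hf, htop, hfF⟩ := hA
  obtain ⟨g, -, hgF, hg⟩ := hB
  have below : ∀ a, f a ⊆ A := by
    rintro (p | a | u) <;> rw [← htop] <;> refine (hf _ _).1 ?_
    · exact Sum.Lex.inl_le_inr _ _
    · exact Sum.Lex.inr_le_inr_iff.2 (Sum.Lex.inl_le_inr _ _)
    · exact le_rfl
  have not_above : ∀ a, a ≠ toLex (Sum.inr (toLex (Sum.inr Unit.unit))) → ¬ A ⊆ f a := by
    intro a ha h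
    rw [← htop, ← hf] at h
    exact ha (le_antisymm ((hf _ _).2 (htop ▸ below a)) h)
  have above : ∀ q, A ⊆ g q := fun q => hAB.trans (hgF q).2
  let φ : P₂ ⊕ₗ (AC k ⊕ₗ P₁) → Finset (Fin n) := fun x =>
    Sum.elim (fun p => f (toLex (Sum.inl p)))
      (fun y => Sum.elim (fun a => f (toLex (Sum.inr (toLex (Sum.inl a))))) g (ofLex y)) (ofLex x)
  have hφ : ∀ a b, a ≤ b ↔ φ a ⊆ φ b := by
    rintro (p | a | q) (p' | a' | q')
    · exact Sum.Lex.inl_le_inl_iff.trans (Sum.Lex.inl_le_inl_iff.symm.trans (hf _ _))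
    · exact iff_of_true (Sum.Lex.inl_le_inr _ _) ((hf _ _).1 (Sum.Lex.inl_le_inr _ _))
    · exact iff_of_true (Sum.Lex.inl_le_inr _ _) ((below _).trans (above _))
    · exact iff_of_false Sum.Lex.not_inr_le_inl
        fun h => Sum.Lex.not_inr_le_inl ((hf _ _).2 h)
    · exact (Sum.Lex.inr_le_inr_iff.trans Sum.Lex.inl_le_inl_iff).trans
        ((Sum.Lex.inr_le_inr_iff.trans Sum.Lex.inl_le_inl_iff).symm.trans (hf _ _))
    · exact iff_of_true (Sum.Lex.inr_le_inr_iff.2 (Sum.Lex.inl_le_inr _ _))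
        ((below _).trans (above _))
    · exact iff_of_false Sum.Lex.not_inr_le_inl
        fun h => not_above _ (by rintro ⟨⟩) ((above _).trans h)
    · exact iff_of_false (fun h => Sum.Lex.not_inr_le_inl (Sum.Lex.inr_le_inr_iff.1 h))
        fun h => not_above _ (by rintro ⟨⟩) ((above _).trans h)
    · exact (Sum.Lex.inr_le_inr_iff.trans Sum.Lex.inr_le_inr_iff).trans (hg _ _)
  refine ⟨φ, fun a b h => le_antisymm ((hφ _ _).2 h.subset) ((hφ _ _).2 h.superset), ?_, hφ⟩
  rintro (p | a | q)
  · exact hfF _ (by rintro ⟨⟩)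
  · exact hfF _ (by rintro ⟨⟩)
  · exact (hgF q).1

/-- `ℒ` and `𝒩` are disjoint and `ℒ ∪ 𝒩` contains no induced copy of the
two-element chain `C₂`. -/
theorem statement6 {n : ℕ} (P₁ P₂ : Type) [PartialOrder P₁] [PartialOrder P₂]
    [Fintype P₁] [Fintype P₂]
    (k : ℕ) (hk : 2 ≤ k)
    (hP₁ : ∃! a : P₁, IsMin a) (hP₂ : ∃! a : P₂, IsMax a)
    (F : Finset (Finset (Fin n)))
    (hF : IsSaturated (P₂ ⊕ₗ (AC k ⊕ₗ P₁)) F) :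
    Disjoint (Lfam P₁ P₂ k F) (Nfam P₁ F) ∧
    ∀ A ∈ Lfam P₁ P₂ k F ∪ Nfam P₁ F, ∀ B ∈ Lfam P₁ P₂ k F ∪ Nfam P₁ F, ¬ A ⊂ B := by
  refine ⟨Set.disjoint_left.2 fun X hL hN => hL.2 X hN subset_rfl, ?_⟩
  rintro A (hA | hA) B (hB | hB) hAB
  · exact hAB.ne (hB.1.2 A hA.1.1 hAB.subset)
  · exact hF.1 (containsCopy_of_mem_Lzero hA.1.1 hAB.subset hB.1.2)
  · exact hB.2 A hA hAB.subset
  · exact hAB.ne (hA.2 B hB.1 hAB.subset)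
end

section
/- For every X ⊆ [n] with X ∉ ℱ ∪ ℒ ∪ 𝒩, either there exists A ∈ ℒ ∪ 𝒩 with A ⊊ X, or there exists N ∈ 𝒩 with X ⊊ N. -/
open Finset

/-- Replacing the top part `P₁` of an ordinal sum by one of its elements `m`. -/
def topPoint (P₁ P₂ : Type) (k : ℕ) (m : P₁) (a : P₂ ⊕ₗ (AC k ⊕ₗ Unit)) : P₂ ⊕ₗ (AC k ⊕ₗ P₁) :=
  toLex (Sum.map id (fun b => toLex (Sum.map id (fun _ => m) (ofLex b))) (ofLex a))

theorem topPoint_le_iff {P₁ P₂ : Type} [PartialOrder P₁] [PartialOrder P₂] {k : ℕ} (m : P₁)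
    (a b : P₂ ⊕ₗ (AC k ⊕ₗ Unit)) : topPoint P₁ P₂ k m a ≤ topPoint P₁ P₂ k m b ↔ a ≤ b := by
  have key : ∀ c : P₂ ⊕ₗ (AC k ⊕ₗ Unit), (∃ x, c = toLex (Sum.inl x)) ∨
      (∃ x, c = toLex (Sum.inr (toLex (Sum.inl x)))) ∨
      c = toLex (Sum.inr (toLex (Sum.inr Unit.unit))) := by
    rintro (c | c | c)
    · exact Or.inl ⟨c, rfl⟩
    · exact Or.inr (Or.inl ⟨c, rfl⟩)
    · exact Or.inr (Or.inr rfl)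
  rcases key a with ⟨a, rfl⟩ | ⟨a, rfl⟩ | rfl <;>
    rcases key b with ⟨b, rfl⟩ | ⟨b, rfl⟩ | rfl <;> simp [topPoint]

theorem exists_isLeast_of_existsUnique_isMin {P : Type} [PartialOrder P] [Fintype P]
    (h : ∃! a : P, IsMin a) : ∃ m : P, ∀ p, m ≤ p := by
  obtain ⟨m, -, hm⟩ := h
  refine ⟨m, fun p => ?_⟩
  obtain ⟨b, hbp, hb⟩ := (Set.toFinite (Set.univ : Set P)).exists_le_minimal (Set.mem_univ p)
  have hbm : b = m := hm b fun _ h => hb.le_of_le (Set.mem_univ _) h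
  exact hbm ▸ hbp

theorem exists_Nfam_superset {n : ℕ} {P₁ : Type} [PartialOrder P₁] {F : Finset (Finset (Fin n))}
    {A : Finset (Fin n)} (hA : A ∈ Nzero P₁ F) : ∃ N ∈ Nfam P₁ F, A ⊆ N := by
  obtain ⟨N, hAN, hN⟩ := (Set.toFinite (Nzero P₁ F)).exists_le_maximal hA
  exact ⟨N, ⟨hN.prop, fun B hB h => h.antisymm (hN.le_of_ge hB h)⟩, hAN⟩

theorem exists_Lone_subset {n : ℕ} {P₂ : Type} [PartialOrder P₂] {k : ℕ}
    {F : Finset (Finset (Fin n))} {A : Finset (Fin n)}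
    (hA : A ∈ Lzero P₂ k (↑F : Set (Finset (Fin n)))) : ∃ L ∈ Lone P₂ k F, L ⊆ A := by
  obtain ⟨L, hLA, hL⟩ :=
    (Set.toFinite (Lzero P₂ k (↑F : Set (Finset (Fin n))))).exists_le_minimal hA
  exact ⟨L, ⟨hL.prop, fun B hB h => h.antisymm (hL.le_of_le hB h)⟩, hLA⟩

/-- every `X ∉ ℱ ∪ ℒ ∪ 𝒩` strictly contains some member of `ℒ ∪ 𝒩` or is
strictly contained in some member of `𝒩`. -/
theorem statement7 {n : ℕ} (P₁ P₂ : Type) [PartialOrder P₁] [PartialOrder P₂]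
    [Fintype P₁] [Fintype P₂]
    (k : ℕ) (hk : 2 ≤ k)
    (hP₁ : ∃! a : P₁, IsMin a) (hP₂ : ∃! a : P₂, IsMax a)
    (F : Finset (Finset (Fin n)))
    (hF : IsSaturated (P₂ ⊕ₗ (AC k ⊕ₗ P₁)) F)
    (X : Finset (Fin n)) (hX : X ∉ (↑F : Set (Finset (Fin n))) ∪ Lfam P₁ P₂ k F ∪ Nfam P₁ F) :
    (∃ A ∈ Lfam P₁ P₂ k F ∪ Nfam P₁ F, A ⊂ X) ∨ (∃ N ∈ Nfam P₁ F, X ⊂ N) := by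
  simp only [Set.mem_union, not_or] at hX
  obtain ⟨⟨hXF, hXL⟩, hXN⟩ := hX
  obtain ⟨m, hm⟩ := exists_isLeast_of_existsUnique_isMin hP₁
  obtain ⟨f, hfi, hfF, hf⟩ := hF.2 X hXF
  obtain ⟨q, hq⟩ : ∃ q, f q = X := by
    by_contra! h
    exact hF.1 ⟨f, hfi, fun a => (hfF a).resolve_left (h a), hf⟩
  have hmem : ∀ a, a ≠ q → f a ∈ F := fun a ha =>
    (hfF a).resolve_left fun h => ha (hfi (h.trans hq.symm))
  let ι : P₁ → P₂ ⊕ₗ (AC k ⊕ₗ P₁) := fun p => toLex (Sum.inr (toLex (Sum.inr p)))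
  have hι : ∀ p p', ι p ≤ ι p' ↔ p ≤ p' := fun p p' => by
    simp [ι]
  have hιi : Function.Injective ι := fun p p' h =>
    le_antisymm ((hι _ _).1 h.le) ((hι _ _).1 h.ge)
  by_cases hqP : ∃ p, q = ι p
  · obtain ⟨p, rfl⟩ := hqP
    left
    have hL : f (ι m) ∈ Lzero P₂ k (↑F : Set (Finset (Fin n))) := by
      have htop : ∀ a b, a ≤ b ↔ f (topPoint P₁ P₂ k m a) ⊆ f (topPoint P₁ P₂ k m b) :=
        fun a b => by rw [← hf, topPoint_le_iff]
      refine ⟨fun a => f (topPoint P₁ P₂ k m a), fun a b h => ?_, htop, rfl, fun a ha => ?_⟩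
      · exact le_antisymm ((htop a b).2 h.subset) ((htop b a).2 h.superset)
      · refine hmem _ fun h => ha ?_
        rcases a with a | a | a
        · cases h
        · cases h
        · rfl
    obtain ⟨L, hL1, hLm⟩ := exists_Lone_subset hL
    have hLX : L ⊆ X := hLm.trans (hq ▸ (hf _ _).1 ((hι m p).2 (hm p)))
    by_cases hLN : ∃ N ∈ Nfam P₁ F, N ⊆ L
    · obtain ⟨N, hN, hNL⟩ := hLN
      exact ⟨N, Or.inr hN, (hNL.trans hLX).ssubset_of_ne fun h => hXN (h ▸ hN)⟩
    · push Not at hLN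
      have hLf : L ∈ Lfam P₁ P₂ k F := ⟨hL1, hLN⟩
      exact ⟨L, Or.inl hLf, hLX.ssubset_of_ne fun h => hXL (h ▸ hLf)⟩
  · right
    push Not at hqP
    have hιF : ∀ p, f (ι p) ∈ F := fun p => hmem _ (hqP p).symm
    have hN0 : f (ι m) ∈ Nzero P₁ F :=
      ⟨hιF m, fun p => f (ι p), hfi.comp hιi,
        fun p => ⟨hιF p, (hf _ _).1 ((hι m p).2 (hm p))⟩,
        fun p p' => by rw [← hf, hι]⟩
    obtain ⟨N, hN, hmN⟩ := exists_Nfam_superset hN0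
    have hqm : q ≤ ι m := by
      rcases q with a | a | a
      · exact Sum.Lex.sep _ _
      · exact Sum.Lex.inr (Sum.Lex.sep _ _)
      · exact absurd rfl (hqP a)
    have hXm : X ⊆ f (ι m) := hq ▸ (hf _ _).1 hqm
    exact ⟨N, hN, (hXm.trans hmN).ssubset_of_ne fun h => hXF (h ▸ hN.1.1)⟩
end

section
/- For every N ∈ 𝒩 and every i ∈ [n] with i ∉ N, there exists Z ∈ ℱ such that Z \ N = {i}. -/
open Finset

/-- A map reflecting and preserving order into inclusion gives an induced copy. -/
theorem ContainsCopy.of_le_iff {P : Type} [PartialOrder P] {n : ℕ} {F : Set (Finset (Fin n))}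
    (f : P → Finset (Fin n)) (hf : ∀ a, f a ∈ F) (hle : ∀ a b : P, a ≤ b ↔ f a ⊆ f b) :
    ContainsCopy P F :=
  ⟨f, fun a b h => le_antisymm ((hle a b).2 h.subset) ((hle b a).2 h.symm.subset), hf, hle⟩

/-- In a finite poset, a unique minimal element is the least element. -/
theorem isLeast_of_unique_isMin {P : Type} [PartialOrder P] [Fintype P] {m : P}
    (huniq : ∀ b : P, IsMin b → b = m) (p : P) : m ≤ p := by
  obtain ⟨b, hb, hmin⟩ := Set.Finite.exists_le_minimal (Set.toFinite (Set.univ : Set P))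
    (Set.mem_univ p)
  have : IsMin b := fun c hc => hmin.2 (Set.mem_univ c) hc
  rwa [← huniq b this]

/-- An induced copy of `Q` strictly below `N` and an induced copy of `P` above `N` combine to an
induced copy of the linear sum of `Q` and `P`. -/
theorem ContainsCopy.sumLex {P Q : Type} [PartialOrder P] [PartialOrder Q] {n : ℕ}
    {F : Set (Finset (Fin n))} {N : Finset (Fin n)}
    (hQ : ContainsCopy Q {X | X ∈ F ∧ X ⊂ N}) (hP : ContainsCopy P {X | X ∈ F ∧ N ⊆ X}) :
    ContainsCopy (Q ⊕ₗ P) F := by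
  obtain ⟨g, -, hgF, hg⟩ := hQ
  obtain ⟨h, -, hhF, hh⟩ := hP
  refine .of_le_iff (fun x => Sum.elim g h (ofLex x)) ?_ ?_
  · rintro (x | p)
    · exact (hgF x).1
    · exact (hhF p).1
  · rintro (x | p) (y | q)
    · exact Sum.Lex.inl_le_inl_iff.trans (hg x y)
    · exact iff_of_true (Sum.Lex.inl_le_inr x q) ((hgF x).2.subset.trans (hhF q).2)
    · exact iff_of_false Sum.Lex.not_inr_le_inl
        fun hle => (hgF y).2.not_subset ((hhF p).2.trans hle)
    · exact Sum.Lex.inr_le_inr_iff.trans (hh p q)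

/-- The linear sum is associative, as far as containing induced copies is concerned. -/
theorem ContainsCopy.sumLexAssoc {P Q R : Type} [PartialOrder P] [PartialOrder Q] [PartialOrder R]
    {n : ℕ} {F : Set (Finset (Fin n))} (h : ContainsCopy ((P ⊕ₗ Q) ⊕ₗ R) F) :
    ContainsCopy (P ⊕ₗ (Q ⊕ₗ R)) F := by
  obtain ⟨f, -, hF, hf⟩ := h
  let e := OrderIso.sumLexAssoc P Q R
  exact .of_le_iff (fun x => f (e.symm x)) (fun x => hF _)
    fun a b => (e.symm.le_iff_le).symm.trans (hf _ _)

/-- for every `N ∈ 𝒩` and `i ∉ N` there is `Z ∈ ℱ` with `Z \ N = {i}`. -/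
theorem statement9 {n : ℕ} (P₁ P₂ : Type) [PartialOrder P₁] [PartialOrder P₂]
    [Fintype P₁] [Fintype P₂]
    (k : ℕ) (hk : 2 ≤ k)
    (hP₁ : ∃! a : P₁, IsMin a) (hP₂ : ∃! a : P₂, IsMax a)
    (F : Finset (Finset (Fin n)))
    (hF : IsSaturated (P₂ ⊕ₗ (AC k ⊕ₗ P₁)) F)
    (N : Finset (Fin n)) (hN : N ∈ Nfam P₁ F) (i : Fin n) (hi : i ∉ N) :
    ∃ Z ∈ F, Z \ N = {i} := by
  obtain ⟨hfree, hsat⟩ := hF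
  obtain ⟨⟨hNF, hNcopy⟩, hNmax⟩ := hN
  by_cases hSF : insert i N ∈ F
  · exact ⟨_, hSF, by rw [Finset.insert_sdiff_of_notMem _ hi, sdiff_self]; rfl⟩
  obtain ⟨f, hinj, hfF, hf⟩ := hsat _ hSF
  have hmem : ∀ x, f x ≠ insert i N → f x ∈ F := fun x hx => (hfF x).resolve_left hx
  obtain ⟨s, hs⟩ : ∃ s, f s = insert i N := by
    by_contra! hne
    exact hfree ⟨f, hinj, fun x => hmem x (hne x), hf⟩
  have hmemF : ∀ x, x ≠ s → f x ∈ F := fun x hx => hmem x fun h => hx (hinj (h.trans hs.symm))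
  obtain ⟨m, -, hm⟩ := hP₁
  let top (p : P₁) : P₂ ⊕ₗ (AC k ⊕ₗ P₁) := Sum.inrₗ (Sum.inrₗ p)
  let mid (a : AC k) : P₂ ⊕ₗ (AC k ⊕ₗ P₁) := Sum.inrₗ (Sum.inlₗ a)
  let bot (b : P₂) : P₂ ⊕ₗ (AC k ⊕ₗ P₁) := Sum.inlₗ b
  have top_le (p q : P₁) : top p ≤ top q ↔ p ≤ q :=
    Sum.Lex.inr_le_inr_iff.trans Sum.Lex.inr_le_inr_iff
  have mid_lt (a : AC k) (p : P₁) : mid a < top p :=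
    Sum.Lex.inr_lt_inr_iff.2 (Sum.Lex.inl_lt_inr a p)
  have bot_lt_top (b : P₂) (p : P₁) : bot b < top p := Sum.Lex.inl_lt_inr b _
  have bot_lt_mid (b : P₂) (a : AC k) : bot b < mid a := Sum.Lex.inl_lt_inr b _
  have not_lt : ¬ ∀ p, s < top p := by
    intro hlt
    have hsub : insert i N ⊆ f (top m) := hs ▸ (hf _ _).1 (hlt m).le
    have hB : f (top m) ∈ Nzero P₁ F :=
      ⟨hmemF _ (hlt m).ne', .of_le_iff (fun p => f (top p))
        (fun p => ⟨hmemF _ (hlt p).ne',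
          (hf _ _).1 ((top_le m p).2 (isLeast_of_unique_isMin hm p))⟩)
        fun p q => (top_le p q).symm.trans (hf _ _)⟩
    have hNB := hNmax _ hB ((Finset.subset_insert i N).trans hsub)
    exact hi (hNB ▸ hsub (Finset.mem_insert_self i N))
  obtain ⟨p, rfl⟩ : ∃ p, s = top p := by
    rcases s with b | a | p
    · exact absurd (bot_lt_top b) not_lt
    · exact absurd (mid_lt a) not_lt
    · exact ⟨p, rfl⟩
  have mid_sub (a : AC k) : f (mid a) ⊆ insert i N := hs ▸ (hf _ _).1 (mid_lt a p).le
  by_cases hia : ∃ a, i ∈ f (mid a)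
  · obtain ⟨a, ha⟩ := hia
    refine ⟨f (mid a), hmemF _ (mid_lt a p).ne, ?_⟩
    ext j
    have := @mid_sub a j
    simp only [Finset.mem_insert, Finset.mem_sdiff, Finset.mem_singleton] at this ⊢
    constructor
    · exact fun hj => (this hj.1).resolve_right hj.2
    · rintro rfl
      exact ⟨ha, hi⟩
  · push Not at hia
    have mid_sub_N (a : AC k) : f (mid a) ⊆ N :=
      (Finset.subset_insert_iff_of_notMem (hia a)).1 (mid_sub a)
    have : Nontrivial (AC k) := Fin.nontrivial_iff_two_le.2 hk
    have mid_ssub (a : AC k) : f (mid a) ⊂ N := by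
      refine (mid_sub_N a).ssubset_of_ne fun h => ?_
      obtain ⟨b, hb⟩ := exists_ne a
      have hle : mid b ≤ mid a := (hf _ _).2 (h ▸ mid_sub_N b)
      exact hb (Sum.Lex.inl_le_inl_iff.1 (Sum.Lex.inr_le_inr_iff.1 hle))
    obtain ⟨a₀⟩ : Nonempty (AC k) := inferInstance
    have lower : ContainsCopy (P₂ ⊕ₗ AC k) {X | X ∈ (F : Set (Finset (Fin n))) ∧ X ⊂ N} := by
      refine .of_le_iff (fun x => Sum.elim (fun b => f (bot b)) (fun a => f (mid a)) (ofLex x))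
        ?_ ?_
      · rintro (b | a)
        · exact ⟨hmemF _ (bot_lt_top b p).ne,
            ((hf _ _).1 (bot_lt_mid b a₀).le).trans_ssubset (mid_ssub a₀)⟩
        · exact ⟨hmemF _ (mid_lt a p).ne, mid_ssub a⟩
      · rintro (b | a) (b' | a')
        · exact Sum.Lex.inl_le_inl_iff.trans (Sum.Lex.inl_le_inl_iff.symm.trans (hf _ _))
        · exact iff_of_true (Sum.Lex.inl_le_inr b a') ((hf _ _).1 (bot_lt_mid b a').le)
        · exact iff_of_false Sum.Lex.not_inr_le_inl
            fun h => (bot_lt_mid b' a).not_ge ((hf _ _).2 h)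
        · exact Sum.Lex.inr_le_inr_iff.trans
            ((Sum.Lex.inr_le_inr_iff.trans Sum.Lex.inl_le_inl_iff).symm.trans (hf (mid a) (mid a')))
    exact absurd (lower.sumLex hNcopy).sumLexAssoc hfree
end

section
/- For every L ∈ ℒ and every i ∈ L, there exists Z ∈ ℱ such that L \ Z = {i}. -/
open Finset

lemma lexSum_cases {α β γ : Type} (a : α ⊕ₗ (β ⊕ₗ γ)) :
    (∃ x, a = toLex (Sum.inl x)) ∨ (∃ y, a = toLex (Sum.inr (toLex (Sum.inl y)))) ∨
      ∃ z, a = toLex (Sum.inr (toLex (Sum.inr z))) := by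
  rcases a with a | a | a
  exacts [.inl ⟨a, rfl⟩, .inr (.inl ⟨a, rfl⟩), .inr (.inr ⟨a, rfl⟩)]

/-- Replacing the top point of `P₂ ⊕ₗ (Q ⊕ₗ Unit)` by a chosen element of `P₁`. -/
def topTo {P₁ P₂ Q : Type} (p : P₁) : P₂ ⊕ₗ (Q ⊕ₗ Unit) → P₂ ⊕ₗ (Q ⊕ₗ P₁) :=
  fun a => toLex ((ofLex a).map id fun b => toLex ((ofLex b).map id fun _ => p))

lemma topTo_le_topTo {P₁ P₂ Q : Type} [PartialOrder P₁] [PartialOrder P₂] [PartialOrder Q]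
    (p : P₁) (a b : P₂ ⊕ₗ (Q ⊕ₗ Unit)) :
    topTo p a ≤ topTo p b ↔ a ≤ b := by
  obtain ⟨a, rfl⟩ | ⟨a, rfl⟩ | ⟨a, rfl⟩ := lexSum_cases a <;>
    obtain ⟨b, rfl⟩ | ⟨b, rfl⟩ | ⟨b, rfl⟩ := lexSum_cases b <;>
    simp [topTo, Sum.Lex.le_def]

/-- A copy of `P₂ ⊕ₗ (Q ⊕ₗ Unit)` with top `X`, and a copy of `P₁` all of whose members
contain `X`, glue to a copy of `P₂ ⊕ₗ (Q ⊕ₗ P₁)`. -/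
lemma containsCopy_glue {P₁ P₂ Q : Type} [PartialOrder P₁] [PartialOrder P₂] [PartialOrder Q]
    {n : ℕ} {I : Set (Finset (Fin n))} (g : P₂ ⊕ₗ (Q ⊕ₗ Unit) → Finset (Fin n))
    (hg : ∀ a b, a ≤ b ↔ g a ⊆ g b)
    (hgI : ∀ a, a ≠ toLex (Sum.inr (toLex (Sum.inr Unit.unit))) → g a ∈ I)
    (u : P₁ → Finset (Fin n)) (hu : ∀ a b, a ≤ b ↔ u a ⊆ u b) (huI : ∀ a, u a ∈ I)
    (hgu : ∀ a, g (toLex (Sum.inr (toLex (Sum.inr Unit.unit)))) ⊆ u a) :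
    ContainsCopy (P₂ ⊕ₗ (Q ⊕ₗ P₁)) I := by
  have below (a) (p : P₁) : g a ⊆ u p := by
    refine ((hg _ _).1 ?_).trans (hgu p)
    obtain ⟨a, rfl⟩ | ⟨a, rfl⟩ | ⟨a, rfl⟩ := lexSum_cases a <;> simp [Sum.Lex.le_def]
  have not_above (p : P₁) (a) (ha : a ≠ toLex (Sum.inr (toLex (Sum.inr Unit.unit)))) :
      ¬ u p ⊆ g a := by
    intro h
    have hle := (hg _ _).2 ((hgu p).trans h)
    obtain ⟨a, rfl⟩ | ⟨a, rfl⟩ | ⟨a, rfl⟩ := lexSum_cases a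
    · simp [Sum.Lex.le_def] at hle
    · simp [Sum.Lex.le_def] at hle
    · exact ha rfl
  let f : P₂ ⊕ₗ (Q ⊕ₗ P₁) → Finset (Fin n) := fun a =>
    Sum.elim (fun x => g (toLex (Sum.inl x)))
      (fun b => Sum.elim (fun y => g (toLex (Sum.inr (toLex (Sum.inl y))))) u (ofLex b)) (ofLex a)
  have hf : ∀ a b, a ≤ b ↔ f a ⊆ f b := by
    intro a b
    obtain ⟨a, rfl⟩ | ⟨a, rfl⟩ | ⟨a, rfl⟩ := lexSum_cases a <;>
      obtain ⟨b, rfl⟩ | ⟨b, rfl⟩ | ⟨b, rfl⟩ := lexSum_cases b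
    · exact Iff.trans (by simp [Sum.Lex.le_def]) (hg (toLex (Sum.inl a)) (toLex (Sum.inl b)))
    · exact Iff.trans (by simp [Sum.Lex.le_def])
        (hg (toLex (Sum.inl a)) (toLex (Sum.inr (toLex (Sum.inl b)))))
    · exact iff_of_true (by simp [Sum.Lex.le_def]) (below _ b)
    · exact Iff.trans (by simp [Sum.Lex.le_def])
        (hg (toLex (Sum.inr (toLex (Sum.inl a)))) (toLex (Sum.inl b)))
    · exact Iff.trans (by simp [Sum.Lex.le_def])
        (hg (toLex (Sum.inr (toLex (Sum.inl a)))) (toLex (Sum.inr (toLex (Sum.inl b)))))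
    · exact iff_of_true (by simp [Sum.Lex.le_def]) (below _ b)
    · exact iff_of_false (by simp [Sum.Lex.le_def]) (not_above a _ (by simp))
    · exact iff_of_false (by simp [Sum.Lex.le_def]) (not_above a _ (by simp))
    · exact Iff.trans (by simp [Sum.Lex.le_def]) (hu a b)
  refine ⟨f, fun a b h => le_antisymm ((hf a b).2 h.subset) ((hf b a).2 h.symm.subset), ?_, hf⟩
  intro a
  obtain ⟨a, rfl⟩ | ⟨a, rfl⟩ | ⟨a, rfl⟩ := lexSum_cases a
  · exact hgI _ (by simp)
  · exact hgI _ (by simp)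
  · exact huI a

/-- for every `L ∈ ℒ` and `i ∈ L` there is `Z ∈ ℱ` with `L \ Z = {i}`. -/
theorem statement10 {n : ℕ} (P₁ P₂ : Type) [PartialOrder P₁] [PartialOrder P₂]
    [Fintype P₁] [Fintype P₂]
    (k : ℕ) (hk : 2 ≤ k)
    (hP₁ : ∃! a : P₁, IsMin a) (hP₂ : ∃! a : P₂, IsMax a)
    (F : Finset (Finset (Fin n)))
    (hF : IsSaturated (P₂ ⊕ₗ (AC k ⊕ₗ P₁)) F)
    (L : Finset (Fin n)) (hL : L ∈ Lfam P₁ P₂ k F) (i : Fin n) (hi : i ∈ L) :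
    ∃ Z ∈ F, L \ Z = {i} := by
  obtain ⟨⟨⟨g, -, hg, hgL, hgF⟩, hmin⟩, -⟩ := hL
  by_contra! hZ
  have sdiff_eq {Z : Finset (Fin n)} (h : L.erase i ⊆ Z) (hiZ : i ∉ Z) : L \ Z = {i} := by
    ext j
    have := @h j
    grind
  have hSF : L.erase i ∉ F := fun h => hZ _ h (sdiff_eq Subset.rfl (notMem_erase i L))
  obtain ⟨f, hinj, hfF, hf⟩ := hF.2 _ hSF
  have mem_F {a} (ha : f a ≠ L.erase i) : f a ∈ (F : Set (Finset (Fin n))) :=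
    (hfF a).resolve_left ha
  by_cases hp : ∃ p : P₁, f (toLex (Sum.inr (toLex (Sum.inr p)))) = L.erase i
  · obtain ⟨p, hp⟩ := hp
    have htop (a b) : a ≤ b ↔ f (topTo p a) ⊆ f (topTo p b) :=
      (topTo_le_topTo p a b).symm.trans (hf _ _)
    have hinj' : Function.Injective fun a => f (topTo p a) := fun a b h =>
      le_antisymm ((htop a b).2 h.subset) ((htop b a).2 h.symm.subset)
    have hS : L.erase i ∈ Lzero P₂ k (F : Set (Finset (Fin n))) :=
      ⟨fun a => f (topTo p a), hinj', htop, hp, fun a ha => mem_F fun h =>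
        ha (hinj' (h.trans hp.symm))⟩
    exact (notMem_erase i L) ((hmin _ hS (erase_subset i L)).symm ▸ hi)
  · push Not at hp
    obtain ⟨a₀, ha₀⟩ : ∃ a, f a = L.erase i := by
      by_contra! h
      exact hF.1 ⟨f, hinj, fun a => mem_F (h a), hf⟩
    refine hF.1 (containsCopy_glue g hg hgF (fun p => f (toLex (Sum.inr (toLex (Sum.inr p)))))
      (fun a b => Iff.trans (by simp [Sum.Lex.le_def]) (hf _ _)) (fun p => mem_F (hp p)) ?_)
    intro p
    have hsub : L.erase i ⊆ f (toLex (Sum.inr (toLex (Sum.inr p)))) := by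
      rw [← ha₀, ← hf]
      obtain ⟨a, rfl⟩ | ⟨a, rfl⟩ | ⟨a, rfl⟩ := lexSum_cases a₀
      · simp [Sum.Lex.le_def]
      · simp [Sum.Lex.le_def]
      · exact absurd ha₀ (hp a)
    have hip : i ∈ f (toLex (Sum.inr (toLex (Sum.inr p)))) := by
      by_contra hip
      exact hZ _ (mem_F (hp p)) (sdiff_eq hsub hip)
    rw [hgL, ← insert_erase hi]
    exact insert_subset hip hsub
end

section
/- Every L ∈ ℒ satisfies |L| ≤ |ℱ|, and every N ∈ 𝒩 satisfies |N| ≥ n − |ℱ|. -/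
open Finset

/-- `f` is an induced order embedding into the Boolean lattice. -/
def IsInducedCopy {P : Type} [PartialOrder P] {n : ℕ} (f : P → Finset (Fin n)) : Prop :=
  ∀ a b : P, a ≤ b ↔ f a ⊆ f b

theorem IsInducedCopy.injective {P : Type} [PartialOrder P] {n : ℕ}
    {f : P → Finset (Fin n)} (hf : IsInducedCopy f) : Function.Injective f :=
  fun a b h => le_antisymm ((hf a b).2 h.subset) ((hf b a).2 h.symm.subset)

theorem IsInducedCopy.ssubset {P : Type} [PartialOrder P] {n : ℕ}
    {f : P → Finset (Fin n)} (hf : IsInducedCopy f) {a b : P} (h : a < b) : f a ⊂ f b :=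
  ⟨(hf a b).1 h.le, fun h' => h.not_ge ((hf b a).2 h')⟩

theorem IsInducedCopy.sumLex {P Q : Type} [PartialOrder P] [PartialOrder Q] {n : ℕ}
    {f : P → Finset (Fin n)} {g : Q → Finset (Fin n)}
    (hf : IsInducedCopy f) (hg : IsInducedCopy g) (hfg : ∀ a b, f a ⊂ g b) :
    IsInducedCopy (fun x : P ⊕ₗ Q => Sum.elim f g (ofLex x)) := by
  rintro (a | a) (b | b)
  · exact Sum.Lex.inl_le_inl_iff.trans (hf a b)
  · exact iff_of_true (Sum.Lex.inl_lt_inr a b).le (hfg a b).subset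
  · exact iff_of_false Sum.Lex.not_inr_le_inl (hfg b a).not_subset
  · exact Sum.Lex.inr_le_inr_iff.trans (hg a b)

theorem IsInducedCopy.inl {P Q : Type} [PartialOrder P] [PartialOrder Q] {n : ℕ}
    {f : P ⊕ₗ Q → Finset (Fin n)} (hf : IsInducedCopy f) :
    IsInducedCopy (fun a => f (toLex (Sum.inl a))) :=
  fun _ _ => Sum.Lex.inl_le_inl_iff.symm.trans (hf _ _)

theorem IsInducedCopy.inr {P Q : Type} [PartialOrder P] [PartialOrder Q] {n : ℕ}
    {f : P ⊕ₗ Q → Finset (Fin n)} (hf : IsInducedCopy f) :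
    IsInducedCopy (fun a => f (toLex (Sum.inr a))) :=
  fun _ _ => Sum.Lex.inr_le_inr_iff.symm.trans (hf _ _)

theorem IsInducedCopy.inl_ssubset_inr {P Q : Type} [PartialOrder P] [PartialOrder Q] {n : ℕ}
    {f : P ⊕ₗ Q → Finset (Fin n)} (hf : IsInducedCopy f) (a : P) (b : Q) :
    f (toLex (Sum.inl a)) ⊂ f (toLex (Sum.inr b)) :=
  hf.ssubset (Sum.Lex.inl_lt_inr a b)

theorem mem_Lzero_iff {P₂ : Type} [PartialOrder P₂] {k : ℕ} (hk : 0 < k) {n : ℕ}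
    {I : Set (Finset (Fin n))} {X : Finset (Fin n)} :
    X ∈ Lzero P₂ k I ↔ ∃ (f : P₂ → Finset (Fin n)) (g : AC k → Finset (Fin n)),
      IsInducedCopy f ∧ IsInducedCopy g ∧ (∀ a, f a ∈ I) ∧ (∀ i, g i ∈ I) ∧
      (∀ a i, f a ⊂ g i) ∧ ∀ i, g i ⊂ X := by
  constructor
  · rintro ⟨f, -, hf, rfl, hI⟩
    replace hf : IsInducedCopy f := hf
    refine ⟨_, _, hf.inl, hf.inr.inl, fun a => hI _ ?_, fun i => hI _ ?_,
      fun a i => hf.inl_ssubset_inr _ _, fun i => hf.inr.inl_ssubset_inr _ _⟩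
    · exact fun h => Sum.inl_ne_inr h
    · exact fun h => Sum.inl_ne_inr (Sum.inr_injective h)
  · rintro ⟨f, g, hf, hg, hfI, hgI, hfg, hgX⟩
    have hX : IsInducedCopy (fun _ : Unit => X) := fun _ _ => by simp
    have H := hf.sumLex (hg.sumLex hX fun i _ => hgX i) (by
      rintro a (i | u)
      · exact hfg a i
      · exact (hfg a ⟨0, hk⟩).trans (hgX _))
    refine ⟨_, H.injective, H, rfl, ?_⟩
    rintro (a | i | u) h
    · exact hfI a
    · exact hgI i
    · exact absurd rfl h

theorem not_subset_of_mem_Lzero_of_mem_Nzero {P₁ P₂ : Type} [PartialOrder P₁]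
    [PartialOrder P₂] {k : ℕ} (hk : 0 < k) {n : ℕ} {F : Finset (Finset (Fin n))}
    (hF : ¬ ContainsCopy (P₂ ⊕ₗ (AC k ⊕ₗ P₁)) (F : Set (Finset (Fin n))))
    {L M : Finset (Fin n)} (hL : L ∈ Lzero P₂ k (F : Set (Finset (Fin n))))
    (hM : M ∈ Nzero P₁ F) : ¬ L ⊆ M := by
  intro hLM
  obtain ⟨f, g, hf, hg, hfI, hgI, hfg, hgL⟩ := (mem_Lzero_iff hk).1 hL
  obtain ⟨-, h, -, hhF, hh⟩ := hM
  have hgh : ∀ i b, g i ⊂ h b := fun i b =>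
    (hgL i).trans_subset (hLM.trans (hhF b).2)
  have H := hf.sumLex (IsInducedCopy.sumLex hg hh hgh) (by
    rintro a (i | b)
    · exact hfg a i
    · exact (hfg a ⟨0, hk⟩).trans (hgh _ b))
  refine hF ⟨_, H.injective, ?_, H⟩
  rintro (a | i | b)
  · exact hfI a
  · exact hgI i
  · exact (hhF b).1

theorem exists_mem_Nzero_or_mem_Lzero {P₁ P₂ : Type} [PartialOrder P₁]
    [PartialOrder P₂] {m : P₁} (hm : ∀ b, m ≤ b) {k : ℕ} (hk : 0 < k) {n : ℕ}
    {F : Finset (Finset (Fin n))} (hF : IsSaturated (P₂ ⊕ₗ (AC k ⊕ₗ P₁)) F)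
    {S : Finset (Fin n)} (hS : S ∉ F) :
    (∃ M ∈ Nzero P₁ F, S ⊂ M) ∨ S ∈ Lzero P₂ k (F : Set (Finset (Fin n))) := by
  obtain ⟨f, hinj, hfF, hf⟩ := hF.2 S hS
  replace hf : IsInducedCopy f := hf
  have hex : ∃ p, f p = S := by
    by_contra! h
    exact hF.1 ⟨f, hinj, fun a => (hfF a).resolve_left (h a), hf⟩
  obtain ⟨p, rfl⟩ := hex
  have hmem : ∀ q, q ≠ p → f q ∈ F := fun q hq =>
    (hfF q).resolve_left fun h => hq (hinj h)
  have low : (∀ b : P₁, p < toLex (Sum.inr (toLex (Sum.inr b)))) →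
      ∃ M ∈ Nzero P₁ F, f p ⊂ M := fun hp =>
    ⟨_, ⟨hmem _ (hp m).ne', _, hf.inr.inr.injective,
      fun b => ⟨hmem _ (hp b).ne', (hf.inr.inr m b).1 (hm b)⟩, hf.inr.inr⟩,
      hf.ssubset (hp m)⟩
  rcases p with a | i | b
  · exact Or.inl (low fun b => Sum.Lex.inl_lt_inr _ _)
  · exact Or.inl (low fun b => Sum.Lex.inr_lt_inr_iff.2 (Sum.Lex.inl_lt_inr _ _))
  · refine Or.inr ((mem_Lzero_iff hk).2 ⟨_, _, hf.inl, hf.inr.inl, fun a => hmem _ ?_,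
      fun i => hmem _ ?_, fun a i => hf.inl_ssubset_inr _ _,
      fun i => hf.inr.inl_ssubset_inr _ _⟩)
    · exact fun h => Sum.inl_ne_inr h
    · exact fun h => Sum.inl_ne_inr (Sum.inr_injective h)

theorem card_le_of_mem_Lone {P₁ P₂ : Type} [PartialOrder P₁] [PartialOrder P₂]
    {m : P₁} (hm : ∀ b, m ≤ b) {k : ℕ} (hk : 0 < k) {n : ℕ}
    {F : Finset (Finset (Fin n))} (hF : IsSaturated (P₂ ⊕ₗ (AC k ⊕ₗ P₁)) F)
    {L : Finset (Fin n)} (hL : L ∈ Lone P₂ k F) : L.card ≤ F.card := by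
  have key : ∀ x ∈ L, ∃ B ∈ F, L.erase x ⊆ B ∧ x ∉ B := by
    intro x hx
    by_cases hS : L.erase x ∈ F
    · exact ⟨_, hS, subset_rfl, notMem_erase x L⟩
    rcases exists_mem_Nzero_or_mem_Lzero hm hk hF hS with ⟨M, hM, hSM⟩ | hS'
    · refine ⟨M, hM.1, hSM.subset, fun hxM => ?_⟩
      refine not_subset_of_mem_Lzero_of_mem_Nzero hk hF.1 hL.1 hM ?_
      rw [← insert_erase hx]
      exact insert_subset hxM hSM.subset
    · exact absurd (erase_eq_self.1 (hL.2 _ hS' (erase_subset x L))) (not_not.2 hx)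
  choose! B hBF hB hxB using key
  refine card_le_card_of_injOn B hBF fun x hx y hy h => ?_
  by_contra hne
  exact hxB x hx (h ▸ hB y hy (mem_erase.2 ⟨hne, hx⟩))

theorem card_compl_le_of_mem_Nfam {P₁ P₂ : Type} [PartialOrder P₁] [PartialOrder P₂]
    {m : P₁} (hm : ∀ b, m ≤ b) {k : ℕ} (hk : 2 ≤ k) {n : ℕ}
    {F : Finset (Finset (Fin n))} (hF : IsSaturated (P₂ ⊕ₗ (AC k ⊕ₗ P₁)) F)
    {N : Finset (Fin n)} (hN : N ∈ Nfam P₁ F) : Nᶜ.card ≤ F.card := by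
  have hk0 : 0 < k := by omega
  have key : ∀ x ∈ Nᶜ, ∃ B ∈ F, B ⊆ insert x N ∧ x ∈ B := by
    intro x hx
    rw [mem_compl] at hx
    by_cases hS : insert x N ∈ F
    · exact ⟨_, hS, subset_rfl, mem_insert_self x N⟩
    rcases exists_mem_Nzero_or_mem_Lzero hm hk0 hF hS with ⟨M, hM, hSM⟩ | hS'
    · have hNM := hN.2 M hM ((subset_insert x N).trans hSM.subset)
      exact absurd (hNM ▸ hSM.subset (mem_insert_self x N)) hx
    · obtain ⟨f, g, hf, hg, hfI, hgI, hfg, hgX⟩ := (mem_Lzero_iff hk0).1 hS'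
      by_contra! hcon
      have hgN : ∀ i, g i ⊆ N := fun i =>
        (subset_insert_iff_of_notMem (hcon _ (hgI i) (hgX i).subset)).1 (hgX i).subset
      refine not_subset_of_mem_Lzero_of_mem_Nzero hk0 hF.1 ((mem_Lzero_iff hk0).2
        ⟨f, g, hf, hg, hfI, hgI, hfg, fun i => (hgN i).ssubset_of_ne fun h => ?_⟩)
        hN.1 subset_rfl
      have hall : ∀ j, j = i := fun j => (hg j i).2 (h ▸ hgN j)
      have h01 : (⟨0, hk0⟩ : Fin k) = ⟨1, hk⟩ := (hall _).trans (hall _).symm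
      simp at h01
  choose! B hBF hB hxB using key
  refine card_le_card_of_injOn B hBF fun x hx y hy h => ?_
  exact (mem_insert.1 (hB y hy (h ▸ hxB x hx))).resolve_right (mem_compl.1 hx)

/-- every `L ∈ ℒ` has `|L| ≤ |ℱ|` and every `N ∈ 𝒩` has `|N| ≥ n - |ℱ|`. -/
theorem statement11 {n : ℕ} (P₁ P₂ : Type) [PartialOrder P₁] [PartialOrder P₂]
    [Fintype P₁] [Fintype P₂]
    (k : ℕ) (hk : 2 ≤ k)
    (hP₁ : ∃! a : P₁, IsMin a) (hP₂ : ∃! a : P₂, IsMax a)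
    (F : Finset (Finset (Fin n)))
    (hF : IsSaturated (P₂ ⊕ₗ (AC k ⊕ₗ P₁)) F) :
    (∀ L ∈ Lfam P₁ P₂ k F, L.card ≤ F.card) ∧
    (∀ N ∈ Nfam P₁ F, (n : ℤ) - F.card ≤ (N.card : ℤ)) := by
  obtain ⟨m, hmin, huniq⟩ := hP₁
  have hm : ∀ b, m ≤ b := fun b => by
    obtain ⟨c, hcb, hc⟩ := (Set.toFinite (Set.univ : Set P₁)).exists_le_minimal (Set.mem_univ b)
    exact huniq c (fun d hd => hc.2 (Set.mem_univ d) hd) ▸ hcb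
  refine ⟨fun L hL => card_le_of_mem_Lone hm (by omega) hF hL.1, fun N hN => ?_⟩
  have h := card_compl_le_of_mem_Nfam hm hk hF hN
  rw [card_compl, Fintype.card_fin] at h
  omega
end

section
/- Suppose |ℱ| < n/2 and there are at least (n + 1 − |ℱ|)/2 elements i ∈ [n] such that i ∉ N for some N ∈ 𝒩. Then there are at least (n + 1 − 3|ℱ|)/2 elements i ∈ [n] such that i ∈ L for some L ∈ ℒ. -/
open Finset

section Copies

variable {P₁ P₂ : Type} [PartialOrder P₁] [PartialOrder P₂] {k n : ℕ}

/-- The members of `F` contain a copy of `𝒜_k * P₂` all of whose members lie strictly below `S`. -/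
def HasLowerCopy (P₂ : Type) [PartialOrder P₂] (k : ℕ) {n : ℕ} (F : Set (Finset (Fin n)))
    (S : Finset (Fin n)) : Prop :=
  ∃ (u : P₂ → Finset (Fin n)) (v : AC k → Finset (Fin n)),
    (∀ a, u a ∈ F) ∧ (∀ c, v c ∈ F) ∧ (∀ a b, a ≤ b ↔ u a ⊆ u b) ∧ (∀ c d, c ≤ d ↔ v c ⊆ v d) ∧
      (∀ a c, u a ⊂ v c) ∧ ∀ c, v c ⊂ S

theorem HasLowerCopy.mono {F : Set (Finset (Fin n))} {S T : Finset (Fin n)}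
    (h : HasLowerCopy P₂ k F S) (hST : S ⊆ T) : HasLowerCopy P₂ k F T := by
  obtain ⟨u, v, hu, hv, hu', hv', huv, hvS⟩ := h
  exact ⟨u, v, hu, hv, hu', hv', huv, fun c => (hvS c).trans_subset hST⟩

/-- Three families stacked on top of each other form a copy of the linear sum. -/
theorem exists_lex_sum_copy {u : P₂ → Finset (Fin n)} {v : AC k → Finset (Fin n)}
    {g : P₁ → Finset (Fin n)} (hk : 0 < k)
    (hu : ∀ a b, a ≤ b ↔ u a ⊆ u b) (hv : ∀ c d, c ≤ d ↔ v c ⊆ v d)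
    (hg : ∀ p q, p ≤ q ↔ g p ⊆ g q) (huv : ∀ a c, u a ⊂ v c) (hvg : ∀ c p, v c ⊂ g p) :
    ∃ f : (P₂ ⊕ₗ (AC k ⊕ₗ P₁)) → Finset (Fin n),
      Function.Injective f ∧ (∀ x y, x ≤ y ↔ f x ⊆ f y) ∧ (∀ a, f (Sum.inlₗ a) = u a) ∧
        (∀ c, f (Sum.inrₗ (Sum.inlₗ c)) = v c) ∧ ∀ p, f (Sum.inrₗ (Sum.inrₗ p)) = g p := by
  have hug : ∀ a p, u a ⊂ g p := fun a p => (huv a (⟨0, hk⟩ : Fin k)).trans (hvg _ p)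
  let f : (P₂ ⊕ₗ (AC k ⊕ₗ P₁)) → Finset (Fin n) :=
    fun x => Sum.elim u (fun y => Sum.elim v g (ofLex y)) (ofLex x)
  have hf : ∀ x y, x ≤ y ↔ f x ⊆ f y := by
    rintro (a | (c | p)) (b | (d | q))
    · exact Sum.Lex.inl_le_inl_iff.trans (hu a b)
    · exact iff_of_true (Sum.Lex.inl_le_inr _ _) (huv a d).subset
    · exact iff_of_true (Sum.Lex.inl_le_inr _ _) (hug a q).subset
    · exact iff_of_false Sum.Lex.not_inr_le_inl (huv b c).not_subset
    · exact (Sum.Lex.inr_le_inr_iff.trans Sum.Lex.inl_le_inl_iff).trans (hv c d)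
    · exact iff_of_true (Sum.Lex.inr_le_inr_iff.2 (Sum.Lex.inl_le_inr _ _)) (hvg c q).subset
    · exact iff_of_false Sum.Lex.not_inr_le_inl (hug b p).not_subset
    · exact iff_of_false (fun h => Sum.Lex.not_inr_le_inl (Sum.Lex.inr_le_inr_iff.1 h))
        (hvg d p).not_subset
    · exact (Sum.Lex.inr_le_inr_iff.trans Sum.Lex.inr_le_inr_iff).trans (hg p q)
  exact ⟨f, fun x y h => le_antisymm ((hf x y).2 h.subset) ((hf y x).2 h.superset), hf,
    fun _ => rfl, fun _ => rfl, fun _ => rfl⟩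

theorem mem_Lzero_iff_s12 (hk : 0 < k) {F : Set (Finset (Fin n))} {S : Finset (Fin n)} :
    S ∈ Lzero P₂ k F ↔ HasLowerCopy P₂ k F S := by
  constructor
  · rintro ⟨f, hinj, hf, rfl, hF⟩
    have hlt : ∀ x y, x < y → f x ⊂ f y := fun x y h =>
      ((hf x y).1 h.le).ssubset_of_ne (hinj.ne h.ne)
    refine ⟨fun a => f (Sum.inlₗ a), fun c => f (Sum.inrₗ (Sum.inlₗ c)), fun a => hF _ ?_,
      fun c => hF _ ?_, fun a b => ?_, fun c d => ?_, fun a c => hlt _ _ ?_, fun c => hlt _ _ ?_⟩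
    · exact (Sum.Lex.inl_lt_inr _ _).ne
    · exact (Sum.Lex.inr_lt_inr_iff.2 (Sum.Lex.inl_lt_inr _ _)).ne
    · exact Sum.Lex.inl_le_inl_iff.symm.trans (hf _ _)
    · exact (Sum.Lex.inr_le_inr_iff.trans Sum.Lex.inl_le_inl_iff).symm.trans (hf _ _)
    · exact Sum.Lex.inl_lt_inr _ _
    · exact Sum.Lex.inr_lt_inr_iff.2 (Sum.Lex.inl_lt_inr _ _)
  · rintro ⟨u, v, hu, hv, hu', hv', huv, hvS⟩
    obtain ⟨f, hinj, hf, hfu, hfv, hfg⟩ := exists_lex_sum_copy (P₁ := Unit) (g := fun _ => S) hk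
      hu' hv' (fun _ _ => by simp) huv (fun c _ => hvS c)
    refine ⟨f, hinj, hf, hfg (), ?_⟩
    rintro (a | (c | p)) hne
    · exact (hfu a).symm ▸ hu a
    · exact (hfv c).symm ▸ hv c
    · exact absurd rfl hne

theorem HasLowerCopy.not_copy_above (hk : 2 ≤ k) {F : Set (Finset (Fin n))}
    (hF : ¬ ContainsCopy (P₂ ⊕ₗ (AC k ⊕ₗ P₁)) F) {S : Finset (Fin n)}
    (hS : HasLowerCopy P₂ k F S) : ¬ ContainsCopy P₁ {X | X ∈ F ∧ S ⊆ X} := by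
  rintro ⟨g, -, hgF, hg⟩
  obtain ⟨u, v, hu, hv, hu', hv', huv, hvS⟩ := hS
  obtain ⟨f, hinj, hf, hfu, hfv, hfg⟩ := exists_lex_sum_copy (by omega) hu' hv' hg huv
    fun c p => (hvS c).trans_subset (hgF p).2
  refine hF ⟨f, hinj, ?_, hf⟩
  rintro (a | (c | p))
  · exact (hfu a).symm ▸ hu a
  · exact (hfv c).symm ▸ hv c
  · exact (hfg p).symm ▸ (hgF p).1

/-- A set missing from a saturated family plays either the role of an element of `P₁`, or lies
below the whole copy of `P₁`. -/
theorem IsSaturated.hasLowerCopy_or [Finite P₁] (hP₁ : ∃! a : P₁, IsMin a)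
    {F : Finset (Finset (Fin n))} (hF : IsSaturated (P₂ ⊕ₗ (AC k ⊕ₗ P₁)) F)
    {S : Finset (Fin n)} (hS : S ∉ F) :
    HasLowerCopy P₂ k (↑F : Set (Finset (Fin n))) S ∨ ∃ B ∈ Nzero P₁ F, S ⊂ B := by
  obtain ⟨f, hinj, hfF, hf⟩ := hF.2 S hS
  have hlt : ∀ x y, x < y → f x ⊂ f y := fun x y h =>
    ((hf x y).1 h.le).ssubset_of_ne (hinj.ne h.ne)
  obtain ⟨x, hx⟩ : ∃ x, f x = S := by
    by_contra! hne
    exact hF.1 ⟨f, hinj, fun x => (hfF x).resolve_left (hne x), hf⟩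
  have hmem : ∀ y, y ≠ x → f y ∈ F := fun y hy =>
    (hfF y).resolve_left fun h => hy (hinj (h.trans hx.symm))
  have above : (∀ p, x < Sum.inrₗ (Sum.inrₗ p)) → ∃ B ∈ Nzero P₁ F, S ⊂ B := by
    intro hxp
    obtain ⟨m, hm, hmuniq⟩ := hP₁
    have hle : ∀ p, m ≤ p := fun p => by
      obtain ⟨q, hqp, hq⟩ := (Set.finite_univ (α := P₁)).exists_le_minimal (Set.mem_univ p)
      exact hmuniq q (fun r hr => hq.2 (Set.mem_univ r) hr) ▸ hqp
    refine ⟨f (Sum.inrₗ (Sum.inrₗ m)), ⟨hmem _ (hxp m).ne', fun p => f (Sum.inrₗ (Sum.inrₗ p)),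
      fun p q h => ?_, fun p => ⟨hmem _ (hxp p).ne', (hf _ _).1 ?_⟩, fun p q => ?_⟩,
      hx ▸ hlt _ _ (hxp m)⟩
    · exact Sum.inr_injective (Sum.inr_injective (hinj h))
    · exact Sum.Lex.inr_le_inr_iff.2 (Sum.Lex.inr_le_inr_iff.2 (hle p))
    · exact (Sum.Lex.inr_le_inr_iff.trans Sum.Lex.inr_le_inr_iff).symm.trans (hf _ _)
  rcases x with (a | (c | p))
  · exact Or.inr (above fun p => Sum.Lex.inl_lt_inr _ _)
  · exact Or.inr (above fun p => Sum.Lex.inr_lt_inr_iff.2 (Sum.Lex.inl_lt_inr _ _))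
  · left
    refine ⟨fun a => f (Sum.inlₗ a), fun c => f (Sum.inrₗ (Sum.inlₗ c)), fun a => hmem _ ?_,
      fun c => hmem _ ?_, fun a b => ?_, fun c d => ?_, fun a c => hlt _ _ ?_,
      fun c => hx ▸ hlt _ _ ?_⟩
    · exact (Sum.Lex.inl_lt_inr _ _).ne
    · exact (Sum.Lex.inr_lt_inr_iff.2 (Sum.Lex.inl_lt_inr _ _)).ne
    · exact Sum.Lex.inl_le_inl_iff.symm.trans (hf _ _)
    · exact (Sum.Lex.inr_le_inr_iff.trans Sum.Lex.inl_le_inl_iff).symm.trans (hf _ _)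
    · exact Sum.Lex.inl_lt_inr _ _
    · exact Sum.Lex.inr_lt_inr_iff.2 (Sum.Lex.inl_lt_inr _ _)

variable {F : Finset (Finset (Fin n))}

theorem hasLowerCopy_insert_of_mem_Nfam [Finite P₁] (hP₁ : ∃! a : P₁, IsMin a)
    (hF : IsSaturated (P₂ ⊕ₗ (AC k ⊕ₗ P₁)) F) {N : Finset (Fin n)} (hN : N ∈ Nfam P₁ F)
    {i : Fin n} (hi : i ∉ N) (hiF : insert i N ∉ F) :
    HasLowerCopy P₂ k (↑F : Set (Finset (Fin n))) (insert i N) := by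
  refine (hF.hasLowerCopy_or hP₁ hiF).resolve_right ?_
  rintro ⟨B, hB, hlt⟩
  have hNB := (Finset.ssubset_insert hi).trans hlt
  exact hNB.ne (hN.2 B hB hNB.subset)

theorem exists_mem_sdiff_eq_singleton [Finite P₁] (hk : 2 ≤ k) (hP₁ : ∃! a : P₁, IsMin a)
    (hF : IsSaturated (P₂ ⊕ₗ (AC k ⊕ₗ P₁)) F) {N : Finset (Fin n)} (hN : N ∈ Nfam P₁ F)
    {i : Fin n} (hi : i ∉ N) : ∃ A ∈ F, A \ N = {i} := by
  suffices h : ∃ A ∈ F, i ∈ A ∧ A ⊆ insert i N by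
    obtain ⟨A, hA, hiA, hAN⟩ := h
    refine ⟨A, hA, ?_⟩
    ext j
    have := @hAN j
    simp only [mem_insert, mem_sdiff, mem_singleton] at *
    grind
  by_cases hiF : insert i N ∈ F
  · exact ⟨_, hiF, mem_insert_self i N, subset_rfl⟩
  obtain ⟨u, v, hu, hv, hu', hv', huv, hvS⟩ := hasLowerCopy_insert_of_mem_Nfam hP₁ hF hN hi hiF
  by_contra! hA
  have hvN : ∀ c, v c ⊆ N := fun c =>
    (Finset.subset_insert_iff_of_notMem fun hic => hA _ (hv c) hic (hvS c).subset).1 (hvS c).subset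
  refine HasLowerCopy.not_copy_above hk hF.1
    ⟨u, v, hu, hv, hu', hv', huv, fun c => (hvN c).ssubset_of_ne fun hc => ?_⟩ hN.1.2
  have hall : ∀ d : AC k, d = c := fun d => (hv' d c).2 (hc ▸ hvN d)
  have h01 : (⟨0, by omega⟩ : Fin k) = ⟨1, by omega⟩ := (hall _).trans (hall _).symm
  simp at h01

theorem le_card_add_card_of_mem_Nfam [Finite P₁] (hk : 2 ≤ k) (hP₁ : ∃! a : P₁, IsMin a)
    (hF : IsSaturated (P₂ ⊕ₗ (AC k ⊕ₗ P₁)) F) {N : Finset (Fin n)} (hN : N ∈ Nfam P₁ F) :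
    n ≤ N.card + F.card := by
  have hle : Nᶜ.card ≤ F.card := by
    choose! A hAF hA using fun (i : Fin n) (hi : i ∈ Nᶜ) =>
      exists_mem_sdiff_eq_singleton hk hP₁ hF hN (mem_compl.1 hi)
    refine card_le_card_of_injOn A hAF fun i hi j hj hij => ?_
    exact singleton_injective ((hA i hi).symm.trans (hij ▸ hA j hj))
  have := N.card_add_card_compl
  rw [Fintype.card_fin] at this
  omega

theorem card_le_card_of_mem_Lone [Finite P₁] (hk : 2 ≤ k) (hP₁ : ∃! a : P₁, IsMin a)
    (hF : IsSaturated (P₂ ⊕ₗ (AC k ⊕ₗ P₁)) F) {L : Finset (Fin n)} (hL : L ∈ Lone P₂ k F) :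
    L.card ≤ F.card := by
  have hk0 : 0 < k := by omega
  have key : ∀ j ∈ L, ∃ B ∈ F, L \ B = {j} := by
    intro j hj
    suffices h : ∃ B ∈ F, j ∉ B ∧ L.erase j ⊆ B by
      obtain ⟨B, hB, hjB, hLB⟩ := h
      refine ⟨B, hB, ?_⟩
      ext i
      have := @hLB i
      simp only [mem_erase, mem_sdiff, mem_singleton] at *
      grind
    by_cases hjF : L.erase j ∈ F
    · exact ⟨_, hjF, notMem_erase j L, subset_rfl⟩
    rcases hF.hasLowerCopy_or hP₁ hjF with h | ⟨B, hB, hlt⟩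
    · exact absurd (hL.2 _ ((mem_Lzero_iff_s12 hk0).2 h) (erase_subset j L)) (erase_ssubset hj).ne
    · refine ⟨B, hB.1, fun hjB => ?_, hlt.subset⟩
      have hLB : L ⊆ B := by
        rw [← insert_erase hj]
        exact insert_subset hjB hlt.subset
      exact (((mem_Lzero_iff_s12 hk0).1 hL.1).mono hLB).not_copy_above hk hF.1 hB.2
  choose! B hBF hB using key
  refine card_le_card_of_injOn B hBF fun i hi j hj hij => ?_
  exact singleton_injective ((hB i hi).symm.trans (hij ▸ hB j hj))

theorem exists_mem_Lfam [Finite P₁] (hk : 2 ≤ k) (hP₁ : ∃! a : P₁, IsMin a)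
    (hF : IsSaturated (P₂ ⊕ₗ (AC k ⊕ₗ P₁)) F) (hsmall : 2 * F.card < n)
    {N : Finset (Fin n)} (hN : N ∈ Nfam P₁ F) {i : Fin n} (hi : i ∉ N) (hiF : insert i N ∉ F) :
    ∃ L ∈ Lfam P₁ P₂ k F, i ∈ L := by
  have hk0 : 0 < k := by omega
  have hS := (mem_Lzero_iff_s12 hk0).2 (hasLowerCopy_insert_of_mem_Nfam hP₁ hF hN hi hiF)
  obtain ⟨L, hLS, hL⟩ := (Set.toFinite (Lzero P₂ k (↑F : Set (Finset (Fin n))))).exists_le_minimal hS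
  have hL1 : L ∈ Lone P₂ k F := ⟨hL.1, fun Y hY hYL => hYL.antisymm (hL.2 hY hYL)⟩
  refine ⟨L, ⟨hL1, fun N' hN' hN'L => ?_⟩, ?_⟩
  · have h₁ := card_le_card_of_mem_Lone hk hP₁ hF hL1
    have h₂ := le_card_add_card_of_mem_Nfam hk hP₁ hF hN'
    have h₃ := card_le_card hN'L
    omega
  · by_contra hiL
    exact (((mem_Lzero_iff_s12 hk0).1 hL.1).mono
      ((subset_insert_iff_of_notMem hiL).1 hLS)).not_copy_above hk hF.1 hN.1.2

end Copies

/-- Fewer than `|F|` elements are the difference of two members of a nonempty family `F`. -/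
theorem card_filter_insert_mem_lt {α : Type*} [Fintype α] [DecidableEq α] (F : Finset (Finset α))
    (hF : F.Nonempty) :
    (univ.filter fun i => ∃ A ∈ F, i ∉ A ∧ insert i A ∈ F).card < F.card := by
  induction F using Finset.strongInduction with
  | H F ih =>
    rcases (univ.filter fun i => ∃ A ∈ F, i ∉ A ∧ insert i A ∈ F).eq_empty_or_nonempty with
      hD | ⟨i, hi⟩
    · rw [hD, card_empty]
      exact hF.card_pos
    obtain ⟨A, hA, hiA, hiF⟩ := (mem_filter.1 hi).2
    have h₁ := ih (F.filter (i ∈ ·)) (filter_ssubset.2 ⟨A, hA, hiA⟩)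
      ⟨_, mem_filter.2 ⟨hiF, mem_insert_self i A⟩⟩
    have h₀ := ih (F.filter (i ∉ ·))
      (filter_ssubset.2 ⟨_, hiF, not_not.2 (mem_insert_self i A)⟩) ⟨A, mem_filter.2 ⟨hA, hiA⟩⟩
    have hsub : (univ.filter fun j => ∃ A ∈ F, j ∉ A ∧ insert j A ∈ F) ⊆
        insert i ((univ.filter fun j => ∃ A ∈ F.filter (i ∈ ·), j ∉ A ∧
            insert j A ∈ F.filter (i ∈ ·)) ∪
          univ.filter fun j => ∃ A ∈ F.filter (i ∉ ·), j ∉ A ∧ insert j A ∈ F.filter (i ∉ ·)) := by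
      intro j hj
      obtain ⟨B, hB, hjB, hjF⟩ := (mem_filter.1 hj).2
      rcases eq_or_ne j i with rfl | hji
      · exact mem_insert_self _ _
      refine mem_insert_of_mem (mem_union.2 ?_)
      by_cases hiB : i ∈ B
      · exact Or.inl (mem_filter.2 ⟨mem_univ j, B, mem_filter.2 ⟨hB, hiB⟩, hjB,
          mem_filter.2 ⟨hjF, mem_insert_of_mem hiB⟩⟩)
      · exact Or.inr (mem_filter.2 ⟨mem_univ j, B, mem_filter.2 ⟨hB, hiB⟩, hjB,
          mem_filter.2 ⟨hjF, by simp [hiB, hji.symm]⟩⟩)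
    have h₂ := (card_le_card hsub).trans ((card_insert_le _ _).trans
      (Nat.add_le_add_right (card_union_le _ _) 1))
    have h₃ := card_filter_add_card_filter_not (s := F) (i ∈ ·)
    omega

/-- if `|ℱ| < n/2` and at least `(n+1-|ℱ|)/2` coordinates avoid some
member of `𝒩`, then at least `(n+1-3|ℱ|)/2` coordinates lie in some member of `ℒ`. -/
theorem statement12 {n : ℕ} (P₁ P₂ : Type) [PartialOrder P₁] [PartialOrder P₂]
    [Fintype P₁] [Fintype P₂]
    (k : ℕ) (hk : 2 ≤ k)
    (hP₁ : ∃! a : P₁, IsMin a) (hP₂ : ∃! a : P₂, IsMax a)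
    (F : Finset (Finset (Fin n)))
    (hF : IsSaturated (P₂ ⊕ₗ (AC k ⊕ₗ P₁)) F)
    (hsmall : (F.card : ℝ) < (n : ℝ) / 2)
    (hN : ((n : ℝ) + 1 - F.card) / 2 ≤ ({i : Fin n | ∃ N ∈ Nfam P₁ F, i ∉ N}.ncard : ℝ)) :
    ((n : ℝ) + 1 - 3 * F.card) / 2 ≤ ({i : Fin n | ∃ L ∈ Lfam P₁ P₂ k F, i ∈ L}.ncard : ℝ) := by
  have hsmall' : 2 * F.card < n := by
    have : (2 * F.card : ℝ) < n := by linarith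
    exact_mod_cast this
  set D := univ.filter fun i : Fin n => ∃ A ∈ F, i ∉ A ∧ insert i A ∈ F with hD
  have hDF : D.card ≤ F.card := by
    rcases F.eq_empty_or_nonempty with rfl | hne
    · simp [hD]
    · exact (card_filter_insert_mem_lt F hne).le
  have hsub : {i : Fin n | ∃ N ∈ Nfam P₁ F, i ∉ N} ⊆
      ↑D ∪ {i : Fin n | ∃ L ∈ Lfam P₁ P₂ k F, i ∈ L} := by
    rintro i ⟨N, hNF, hi⟩
    by_cases hiF : insert i N ∈ F
    · exact Or.inl (mem_coe.2 (mem_filter.2 ⟨mem_univ i, N, hNF.1.1, hi, hiF⟩))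
    · exact Or.inr (exists_mem_Lfam hk hP₁ hF hsmall' hNF hi hiF)
  have hcard := (Set.ncard_le_ncard hsub).trans (Set.ncard_union_le _ _)
  rw [Set.ncard_coe_finset] at hcard
  have hcard' : ({i : Fin n | ∃ N ∈ Nfam P₁ F, i ∉ N}.ncard : ℝ) ≤
      F.card + {i : Fin n | ∃ L ∈ Lfam P₁ P₂ k F, i ∈ L}.ncard := by
    exact_mod_cast hcard.trans (Nat.add_le_add_right hDF _)
  linarith
end
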